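/- There exists a reflective oracle that is limit computable. -/

import Mathlib

namespace GrainOfTruth

open scoped Classical

/-- A probabilistic oracle Turing machine is given by a code of a partial
recursive function describing its finite-step behavior: on (input, bits received so far)
it either outputs a bit, flips a fair coin, or queries the oracle. -/
abbrev Machine := Nat.Partrec.Code

/-- A query to the oracle: a machine `T`, an input `x`, and a rational `p`. -/
abbrev Query := Machine × List Bool × ℚ

/-- An oracle probabilistically answers each query with `0` or `1`; we represent it by
the probability of answering `1`. -/
def IsOracle (O : Query → ℝ) : Prop := ∀ q, 0 ≤ O q ∧ O q ≤ 1

instance : Denumerable (List Bool) := Denumerable.ofEncodableOfInfinite _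

/-- The action a machine performs at a given configuration. -/
inductive Action : Type
  | output : Bool → Action
  | flip : Action
  | ask : Query → Action

/-- Decoding a natural number as an action. -/
def decodeAction : ℕ → Action
  | 0 => .output false
  | 1 => .output true
  | 2 => .flip
  | (n + 3) => .ask (Denumerable.ofNat Query n)

/-- The action performed by machine `T` on input `x` after having received the
bits `s` (fair coin flips and oracle answers) so far. -/
def act (T : Machine) (x s : List Bool) : Part Action :=
  (T.eval (Nat.pair (Encodable.encode x) (Encodable.encode s))).map decodeAction

/-- Probability that the next received bit is `b`, given the current action. -/
noncomputable def bitProb (O : Query → ℝ) : Action → Bool → ℝ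
  | .output _, _ => 0
  | .flip, _ => 1 / 2
  | .ask q, b => if b then O q else 1 - O q

/-- Probability that, running `T` with oracle `O` on input `x`, having already received
the bits `pre`, the machine receives exactly the further bits `s`. -/
noncomputable def traceWeightAux (T : Machine) (O : Query → ℝ) (x : List Bool) :
    List Bool → List Bool → ℝ
  | _pre, [] => 1
  | pre, b :: rest =>
      (if h : (act T x pre).Dom then bitProb O ((act T x pre).get h) b else 0) *
        traceWeightAux T O x (pre ++ [b]) rest

/-- `lam T O x b` is the probability λ_T^O(b|x) that machine `T`, run with oracle `O`
on input `x`, outputs the bit `b`. -/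
noncomputable def lam (T : Machine) (O : Query → ℝ) (x : List Bool) (b : Bool) : ℝ :=
  ∑' s : { s : List Bool // act T x s = Part.some (Action.output b) },
    traceWeightAux T O x [] s.1

/-- An oracle `O` is reflective iff for every query `(T, x, p)`:
if λ_T^O(1|x) > p then `O` answers `1` with probability one, and
if λ_T^O(0|x) > 1 - p then `O` answers `0` with probability one. -/
def Reflective (O : Query → ℝ) : Prop :=
  IsOracle O ∧
    ∀ (T : Machine) (x : List Bool) (p : ℚ),
      ((p : ℝ) < lam T O x true → O (T, x, p) = 1) ∧
      (1 - (p : ℝ) < lam T O x false → O (T, x, p) = 0)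

/-- A real-valued function on queries is limit computable iff there is a computable
function `φ` (on codes of queries) such that `φ q k → O q` as `k → ∞`. -/
def LimitComputable (O : Query → ℝ) : Prop :=
  ∃ φ : ℕ → ℕ → ℚ, Computable₂ φ ∧
    ∀ q : Query,
      Filter.Tendsto (fun k => ((φ (Encodable.encode q) k : ℚ) : ℝ)) Filter.atTop
        (nhds (O q))

end GrainOfTruth

namespace GrainOfTruth

open scoped Classical

section Brouwer

variable {ι : Type*} [DecidableEq ι]

/-- The cup product over `ZMod 2` of the coboundaries of a list of functions on the grid `ι → ℕ`,
evaluated on the unit cube with lowest vertex `x` spanned by the directions in `A`. -/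
def cupCoboundary : List ((ι → ℕ) → ZMod 2) → Finset ι → (ι → ℕ) → ZMod 2
  | [], _, _ => 1
  | l :: L, A, x =>
      ∑ d ∈ A, (l (x + Pi.single d 1) - l x) * cupCoboundary L (A.erase d) (x + Pi.single d 1)

theorem sum_erase_erase_comm {M : Type*} [AddCommMonoid M] (A : Finset ι) (f : ι → ι → M) :
    ∑ d ∈ A, ∑ e ∈ A.erase d, f d e = ∑ d ∈ A, ∑ e ∈ A.erase d, f e d := by
  refine Finset.sum_comm' fun d e => ?_
  simp only [Finset.mem_erase]
  tauto

theorem sum_erase_erase_eq_zero (A : Finset ι) (f : ι → ι → ZMod 2) (hf : ∀ d e, f d e = f e d) :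
    ∑ d ∈ A, ∑ e ∈ A.erase d, f d e = 0 := by
  induction A using Finset.induction_on with
  | empty => simp
  | insert a A ha ih =>
    have key : ∀ d ∈ A, ∑ e ∈ (insert a A).erase d, f d e = f a d + ∑ e ∈ A.erase d, f d e := by
      intro d hd
      have hda : a ≠ d := fun h => ha (h ▸ hd)
      rw [Finset.erase_insert_of_ne hda, Finset.sum_insert (by simp [ha]), hf]
    rw [Finset.sum_insert ha, Finset.erase_insert ha, Finset.sum_congr rfl key,
      Finset.sum_add_distrib, ih, add_zero, CharTwo.add_self_eq_zero]

theorem sum_cupCoboundary_shift (L : List ((ι → ℕ) → ZMod 2)) :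
    ∀ (A : Finset ι) (x : ι → ℕ),
      ∑ d ∈ A, cupCoboundary L (A.erase d) (x + Pi.single d 1) =
        ∑ d ∈ A, cupCoboundary L (A.erase d) x := by
  induction L with
  | nil => intro A x; simp [cupCoboundary]
  | cons l L ih =>
    intro A x
    have hcomm : ∀ d e : ι, x + Pi.single d 1 + Pi.single e 1 = x + Pi.single e 1 + Pi.single d 1 :=
      fun d e => add_right_comm _ _ _
    have h1 : ∑ d ∈ A, ∑ e ∈ A.erase d, l (x + Pi.single d 1 + Pi.single e 1) *
        cupCoboundary L ((A.erase d).erase e) (x + Pi.single d 1 + Pi.single e 1) = 0 :=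
      sum_erase_erase_eq_zero A (fun d e => l (x + Pi.single d 1 + Pi.single e 1) *
        cupCoboundary L ((A.erase d).erase e) (x + Pi.single d 1 + Pi.single e 1))
        fun d e => by rw [hcomm, Finset.erase_right_comm]
    have h2 : ∑ d ∈ A, ∑ e ∈ A.erase d, l (x + Pi.single d 1) *
        cupCoboundary L ((A.erase d).erase e) (x + Pi.single d 1 + Pi.single e 1) =
        ∑ d ∈ A, ∑ e ∈ A.erase d, l (x + Pi.single d 1) *
        cupCoboundary L ((A.erase d).erase e) (x + Pi.single d 1) :=
      Finset.sum_congr rfl fun d _ => by rw [← Finset.mul_sum, ← Finset.mul_sum, ih]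
    have h3 : ∑ d ∈ A, ∑ e ∈ A.erase d, l x *
        cupCoboundary L ((A.erase d).erase e) (x + Pi.single e 1) = 0 := by
      have : ∀ d ∈ A, ∑ e ∈ A.erase d, l x *
          cupCoboundary L ((A.erase d).erase e) (x + Pi.single e 1) =
          ∑ e ∈ A.erase d, l x * cupCoboundary L ((A.erase d).erase e) x :=
        fun d _ => by rw [← Finset.mul_sum, ← Finset.mul_sum, ih]
      rw [Finset.sum_congr rfl this]
      exact sum_erase_erase_eq_zero A (fun d e => l x * cupCoboundary L ((A.erase d).erase e) x)
        fun d e => by rw [Finset.erase_right_comm]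
    have h4 : ∑ d ∈ A, ∑ e ∈ A.erase d, l (x + Pi.single e 1) *
        cupCoboundary L ((A.erase d).erase e) (x + Pi.single e 1) =
        ∑ d ∈ A, ∑ e ∈ A.erase d, l (x + Pi.single d 1) *
        cupCoboundary L ((A.erase d).erase e) (x + Pi.single d 1) := by
      rw [sum_erase_erase_comm]
      exact Finset.sum_congr rfl fun d _ => Finset.sum_congr rfl fun e _ => by
        rw [Finset.erase_right_comm]
    simp only [cupCoboundary, sub_mul, Finset.sum_sub_distrib]
    rw [h1, h2, h3, h4, zero_sub, sub_zero, CharTwo.neg_eq]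

theorem cupCoboundary_cons_eq (l : (ι → ℕ) → ZMod 2) (L : List ((ι → ℕ) → ZMod 2))
    (A : Finset ι) (x : ι → ℕ) :
    cupCoboundary (l :: L) A x =
      ∑ d ∈ A, (l (x + Pi.single d 1) * cupCoboundary L (A.erase d) (x + Pi.single d 1) -
        l x * cupCoboundary L (A.erase d) x) := by
  simp only [cupCoboundary, sub_mul, Finset.sum_sub_distrib]
  rw [← Finset.mul_sum, ← Finset.mul_sum, sum_cupCoboundary_shift]

theorem cupCoboundary_eq_zero {l : (ι → ℕ) → ZMod 2} {d : ι} {c : ZMod 2} {k : ℕ}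
    (hl : ∀ y : ι → ℕ, y d = k → l y = c) (L : List ((ι → ℕ) → ZMod 2)) (hL : l ∈ L) :
    ∀ (A : Finset ι) (x : ι → ℕ), d ∉ A → x d = k → cupCoboundary L A x = 0 := by
  induction L with
  | nil => simp at hL
  | cons l' L ih =>
    intro A x hd hx
    refine Finset.sum_eq_zero fun e he => ?_
    have hed : d ≠ e := fun h => hd (h ▸ he)
    have hx' : (x + Pi.single e 1 : ι → ℕ) d = k := by simp [hed, hx]
    rcases List.mem_cons.1 hL with rfl | h
    · rw [hl _ hx', hl _ hx, sub_self, zero_mul]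
    · rw [ih h _ _ (fun h => hd (Finset.mem_of_mem_erase h)) hx', mul_zero]

theorem exists_ne_of_cupCoboundary_ne_zero (L : List ((ι → ℕ) → ZMod 2)) :
    ∀ (A : Finset ι) (x : ι → ℕ), cupCoboundary L A x ≠ 0 → ∀ l ∈ L, ∃ r s : ι → ℕ,
      (∀ i, x i ≤ r i ∧ r i ≤ x i + 1 ∧ x i ≤ s i ∧ s i ≤ x i + 1) ∧
      (∀ i ∉ A, r i = x i ∧ s i = x i) ∧ l r ≠ l s := by
  induction L with
  | nil => simp
  | cons l' L ih =>
    intro A x hW l hl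
    obtain ⟨d, hd, hne⟩ := Finset.exists_ne_zero_of_sum_ne_zero hW
    have hsingle : ∀ i, i ≠ d → (x + Pi.single d 1 : ι → ℕ) i = x i := fun i hi => by simp [hi]
    have hd1 : (x + Pi.single d 1 : ι → ℕ) d = x d + 1 := by simp
    rcases List.mem_cons.1 hl with rfl | h
    · refine ⟨x + Pi.single d 1, x, fun i => ?_, fun i hi => ?_, fun h => hne (by simp [h])⟩
      · by_cases hi : i = d
        · subst hi; omega
        · have := hsingle i hi; omega
      · exact ⟨hsingle i fun h => hi (h ▸ hd), rfl⟩
    · obtain ⟨r, s, hb, hA, hrs⟩ := ih _ _ (right_ne_zero_of_mul hne) l h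
      refine ⟨r, s, fun i => ?_, fun i hi => ?_, hrs⟩
      · by_cases hi : i = d
        · subst hi
          have := hA i (by simp)
          omega
        · have := hsingle i hi
          have := hb i
          omega
      · have := hsingle i fun h => hi (h ▸ hd)
        have := hA i (by simp [hi])
        omega

variable [Fintype ι]

/-- The grid points whose coordinates are less than `m` along `A` and equal to `m` elsewhere. -/
def gridFace (m : ℕ) (A : Finset ι) : Finset (ι → ℕ) :=
  Fintype.piFinset fun i => if i ∈ A then Finset.range m else {m}

theorem mem_gridFace {m : ℕ} {A : Finset ι} {x : ι → ℕ} :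
    x ∈ gridFace m A ↔ ∀ i, if i ∈ A then x i < m else x i = m := by
  simp only [gridFace, Fintype.mem_piFinset]
  refine forall_congr' fun i => ?_
  split_ifs <;> simp

theorem sum_gridFace {M : Type*} [AddCommMonoid M] (m : ℕ) {A : Finset ι} {d : ι} (hd : d ∈ A)
    (h : (ι → ℕ) → M) :
    ∑ x ∈ gridFace m A, h x =
      ∑ x ∈ gridFace m (A.erase d), ∑ k ∈ Finset.range m, h (Function.update x d k) := by
  rw [← Finset.sum_product']
  refine Finset.sum_bij' (fun x _ => (Function.update x d m, x d))
    (fun p _ => Function.update p.1 d p.2) ?_ ?_ ?_ ?_ ?_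
  · intro x hx
    rw [mem_gridFace] at hx
    rw [Finset.mem_product, mem_gridFace, Finset.mem_range]
    refine ⟨fun i => ?_, by simpa [hd] using hx d⟩
    by_cases hi : i = d
    · subst hi; simp
    · simpa [hi] using hx i
  · rintro ⟨x, k⟩ hp
    rw [Finset.mem_product, mem_gridFace, Finset.mem_range] at hp
    rw [mem_gridFace]
    intro i
    by_cases hi : i = d
    · subst hi; simpa [hd] using hp.2
    · simpa [hi] using hp.1 i
  · intro x _; simp
  · rintro ⟨x, k⟩ hp
    rw [Finset.mem_product, mem_gridFace, Finset.mem_range] at hp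
    have : x d = m := by simpa using hp.1 d
    simp [← this]
  · intro x _; simp

theorem sum_gridFace_sub {M : Type*} [AddCommGroup M] (m : ℕ) {A : Finset ι} {d : ι} (hd : d ∈ A)
    (g : (ι → ℕ) → M) :
    ∑ x ∈ gridFace m A, (g (x + Pi.single d 1) - g x) =
      ∑ x ∈ gridFace m (A.erase d), (g x - g (Function.update x d 0)) := by
  rw [sum_gridFace m hd]
  refine Finset.sum_congr rfl fun x hx => ?_
  have hxd : x d = m := by simpa using mem_gridFace.1 hx d
  have hshift : ∀ k, Function.update x d k + Pi.single d 1 = Function.update x d (k + 1) := by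
    intro k
    ext i
    by_cases hi : i = d
    · subst hi; simp
    · simp [hi]
  simp only [hshift]
  rw [Finset.sum_range_sub fun k => g (Function.update x d k), ← hxd, Function.update_eq_self]

theorem sum_cupCoboundary_eq_one {m : ℕ} {l : ι → (ι → ℕ) → ZMod 2}
    (h0 : ∀ i x, x i = 0 → l i x = 0) (h1 : ∀ i x, x i = m → l i x = 1) (L : List ι) :
    L.Nodup → ∑ x ∈ gridFace m L.toFinset, cupCoboundary (L.map l) L.toFinset x = 1 := by
  induction L with
  | nil => intro _; simp [cupCoboundary, gridFace]
  | cons a L ih =>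
    intro hL
    obtain ⟨haL, hL⟩ := List.nodup_cons.1 hL
    have ha : a ∈ (a :: L).toFinset := by simp
    have her : (a :: L).toFinset.erase a = L.toFinset := by
      rw [List.toFinset_cons, Finset.erase_insert (by simpa using haL)]
    simp only [List.map_cons, cupCoboundary_cons_eq]
    rw [Finset.sum_comm, Finset.sum_eq_single_of_mem a ha, sum_gridFace_sub m ha
      fun x => l a x * cupCoboundary (L.map l) ((a :: L).toFinset.erase a) x, her, ← ih hL]
    · refine Finset.sum_congr rfl fun x hx => ?_
      have hxa : x a = m := by simpa [haL] using mem_gridFace.1 hx a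
      rw [h1 a x hxa, h0 a _ (by simp)]
      simp
    · intro d hd hda
      have hdL : d ∈ L := by simpa [hda] using hd
      rw [sum_gridFace_sub m hd
        fun x => l a x * cupCoboundary (L.map l) ((a :: L).toFinset.erase d) x]
      refine Finset.sum_eq_zero fun x hx => ?_
      have hxd : x d = m := by simpa using mem_gridFace.1 hx d
      rw [cupCoboundary_eq_zero (h1 d) _ (List.mem_map_of_mem hdL) _ _ (by simp) hxd,
        cupCoboundary_eq_zero (h0 d) _ (List.mem_map_of_mem hdL) _ _ (by simp) (by simp)]
      simp

/-- **Kuhn's cubical Sperner lemma**. -/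
theorem exists_cell_forall_ne {m : ℕ} {l : ι → (ι → ℕ) → ZMod 2}
    (h0 : ∀ i x, x i = 0 → l i x = 0) (h1 : ∀ i x, x i = m → l i x = 1) :
    ∃ x : ι → ℕ, (∀ i, x i < m) ∧ ∀ i, ∃ r s : ι → ℕ,
      (∀ j, x j ≤ r j ∧ r j ≤ x j + 1 ∧ x j ≤ s j ∧ s j ≤ x j + 1) ∧ l i r = 0 ∧ l i s = 1 := by
  have hsum := sum_cupCoboundary_eq_one h0 h1 Finset.univ.toList (Finset.nodup_toList _)
  obtain ⟨x, hx, hne⟩ := Finset.exists_ne_zero_of_sum_ne_zero (hsum ▸ one_ne_zero)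
  refine ⟨x, fun i => by simpa using mem_gridFace.1 hx i, fun i => ?_⟩
  obtain ⟨r, s, hrs, -, hl⟩ := exists_ne_of_cupCoboundary_ne_zero _ _ _ hne (l i)
    (List.mem_map_of_mem (by simp))
  have hcases : ∀ a b : ZMod 2, a ≠ b → a = 0 ∧ b = 1 ∨ b = 0 ∧ a = 1 := by decide
  rcases hcases _ _ hl with h | h
  · exact ⟨r, s, hrs, h⟩
  · exact ⟨s, r, fun j => by have := hrs j; omega, h⟩

/-- **Brouwer's fixed point theorem** for the unit cube. -/
theorem exists_fixedPoint_unitCube {F : (ι → ℝ) → ι → ℝ}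
    (hF : ContinuousOn F (Set.Icc 0 1)) (hmaps : Set.MapsTo F (Set.Icc 0 1) (Set.Icc 0 1)) :
    ∃ x ∈ Set.Icc (0 : ι → ℝ) 1, F x = x := by
  have hstep : ∀ n : ℕ, ∃ u ∈ Set.Icc (0 : ι → ℝ) 1, ∀ i, ∃ r ∈ Set.Icc (0 : ι → ℝ) 1,
      ∃ s ∈ Set.Icc (0 : ι → ℝ) 1, dist r u ≤ 1 / ((n : ℝ) + 1) ∧ dist s u ≤ 1 / ((n : ℝ) + 1) ∧
        r i ≤ F r i ∧ F s i ≤ s i := by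
    intro n
    let pt : (ι → ℕ) → ι → ℝ := fun x i => x i / ((n : ℝ) + 1)
    have hn : (0 : ℝ) < (n : ℝ) + 1 := by positivity
    have hpt : ∀ x : ι → ℕ, (∀ i, x i ≤ n + 1) → pt x ∈ Set.Icc (0 : ι → ℝ) 1 := by
      refine fun x hx => ⟨fun i => by simp only [pt, Pi.zero_apply]; positivity, fun i => ?_⟩
      simp only [pt, Pi.one_apply]
      rw [div_le_one hn]
      exact_mod_cast hx i
    have hdist : ∀ x y : ι → ℕ, (∀ i, x i ≤ y i ∧ y i ≤ x i + 1) →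
        dist (pt y) (pt x) ≤ 1 / ((n : ℝ) + 1) := by
      refine fun x y h => (dist_pi_le_iff (by positivity)).2 fun i => ?_
      have h1 : (x i : ℝ) ≤ y i := by exact_mod_cast (h i).1
      have h2 : (y i : ℝ) ≤ x i + 1 := by exact_mod_cast (h i).2
      simp only [pt]
      rw [Real.dist_eq, ← sub_div, abs_of_nonneg (div_nonneg (by linarith) hn.le)]
      gcongr
      linarith
    classical
    let l : ι → (ι → ℕ) → ZMod 2 := fun i x =>
      if x i = 0 then 0 else if x i = n + 1 then 1 else if pt x i < F (pt x) i then 0 else 1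
    obtain ⟨x, hx, hcell⟩ := exists_cell_forall_ne (m := n + 1) (l := l)
      (fun i x h => by simp [l, h]) (fun i x h => by simp [l, h])
    refine ⟨pt x, hpt x fun i => (hx i).le, fun i => ?_⟩
    obtain ⟨r, s, hrs, hr, hs⟩ := hcell i
    have hrI := hpt r fun j => by have := hrs j; have := hx j; omega
    have hsI := hpt s fun j => by have := hrs j; have := hx j; omega
    refine ⟨pt r, hrI, pt s, hsI, hdist x r fun j => ⟨(hrs j).1, (hrs j).2.1⟩,
      hdist x s fun j => (hrs j).2.2, ?_, ?_⟩
    · by_cases h : r i = 0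
      · have : pt r i = 0 := by simp [pt, h]
        rw [this]
        exact (hmaps hrI).1 i
      · by_contra hcon
        simp only [l, h, if_false, if_neg (fun hh => hcon (le_of_lt hh))] at hr
        split_ifs at hr <;> exact absurd hr (by decide)
    · by_cases h : s i = n + 1
      · have : pt s i = 1 := by
          simp only [pt, h]
          push_cast
          exact div_self hn.ne'
        rw [this]
        exact (hmaps hsI).2 i
      · by_contra hcon
        simp only [l, h, if_false, if_pos (not_le.1 hcon)] at hs
        split_ifs at hs <;> exact absurd hs (by decide)
  choose u hu r hr s hs hru hsu hFr hFs using hstep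
  obtain ⟨x, hx, φ, hφ, hlim⟩ := isCompact_Icc.tendsto_subseq hu
  have hsmall : Filter.Tendsto (fun n => 1 / ((φ n : ℝ) + 1)) Filter.atTop (nhds 0) :=
    tendsto_one_div_add_atTop_nhds_zero_nat.comp hφ.tendsto_atTop
  have hnear : ∀ v : ℕ → ι → ℝ, (∀ n, v n ∈ Set.Icc (0 : ι → ℝ) 1) →
      (∀ n, dist (v n) (u n) ≤ 1 / ((n : ℝ) + 1)) →
      Filter.Tendsto (fun n => v (φ n)) Filter.atTop (nhds x) ∧
      Filter.Tendsto (fun n => F (v (φ n))) Filter.atTop (nhds (F x)) := by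
    intro v hv hd
    have hvx : Filter.Tendsto (fun n => v (φ n)) Filter.atTop (nhds x) := by
      refine (tendsto_iff_of_dist ?_).1 hlim
      refine squeeze_zero (fun _ => dist_nonneg) (fun n => ?_) hsmall
      rw [dist_comm]
      exact hd (φ n)
    exact ⟨hvx, (hF x hx).tendsto.comp (tendsto_nhdsWithin_of_tendsto_nhds_of_eventually_within _
      hvx (Filter.Eventually.of_forall fun n => hv _))⟩
  refine ⟨x, hx, funext fun i => le_antisymm ?_ ?_⟩
  · obtain ⟨h1, h2⟩ := hnear (fun n => s n i) (fun n => hs n i) (fun n => hsu n i)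
    exact le_of_tendsto_of_tendsto' (tendsto_pi_nhds.1 h2 i) (tendsto_pi_nhds.1 h1 i)
      fun n => hFs (φ n) i
  · obtain ⟨h1, h2⟩ := hnear (fun n => r n i) (fun n => hr n i) (fun n => hru n i)
    exact le_of_tendsto_of_tendsto' (tendsto_pi_nhds.1 h1 i) (tendsto_pi_nhds.1 h2 i)
      fun n => hFr (φ n) i

end Brouwer

section FiniteTruncation

/-- The probability that the bit received by `T` after `pre` is `b`. -/
noncomputable def stepProb (T : Machine) (O : Query → ℝ) (x pre : List Bool) (b : Bool) : ℝ :=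
  if h : (act T x pre).Dom then bitProb O ((act T x pre).get h) b else 0

theorem traceWeightAux_cons (T : Machine) (O : Query → ℝ) (x pre : List Bool) (b : Bool)
    (s : List Bool) :
    traceWeightAux T O x pre (b :: s) = stepProb T O x pre b * traceWeightAux T O x (pre ++ [b]) s :=
  rfl

theorem bitProb_nonneg {O : Query → ℝ} (hO : IsOracle O) (a : Action) (b : Bool) :
    0 ≤ bitProb O a b := by
  cases a with
  | output c => exact le_rfl
  | flip => norm_num [bitProb]
  | ask q =>
    have := hO q
    cases b <;> simp [bitProb, this]

theorem stepProb_nonneg {O : Query → ℝ} (hO : IsOracle O) (T : Machine) (x pre : List Bool)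
    (b : Bool) : 0 ≤ stepProb T O x pre b := by
  unfold stepProb
  split_ifs
  · exact bitProb_nonneg hO _ _
  · exact le_rfl

theorem stepProb_of_eq {T : Machine} {x pre : List Bool} {a : Action} (O : Query → ℝ)
    (h : act T x pre = Part.some a) (b : Bool) : stepProb T O x pre b = bitProb O a b := by
  unfold stepProb
  simp [h]

theorem stepProb_add_le_one (T : Machine) (O : Query → ℝ) (x pre : List Bool) :
    stepProb T O x pre true + stepProb T O x pre false ≤ 1 := by
  unfold stepProb
  split_ifs with h
  · cases (act T x pre).get h <;> norm_num [bitProb]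
  · norm_num

theorem traceWeightAux_nonneg {O : Query → ℝ} (hO : IsOracle O) (T : Machine) (x : List Bool)
    (s : List Bool) : ∀ pre, 0 ≤ traceWeightAux T O x pre s := by
  induction s with
  | nil => intro _; exact zero_le_one
  | cons b s ih => intro pre; exact mul_nonneg (stepProb_nonneg hO _ _ _ _) (ih _)

/-- The bit strings of length at most `n`. -/
def boundedStrings : ℕ → Finset (List Bool)
  | 0 => {[]}
  | n + 1 => insert [] ((boundedStrings n).image (List.cons true) ∪
      (boundedStrings n).image (List.cons false))

theorem mem_boundedStrings {n : ℕ} : ∀ {s : List Bool}, s.length ≤ n → s ∈ boundedStrings n := by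
  induction n with
  | zero => intro s hs; simpa [boundedStrings] using hs
  | succ n ih =>
    intro s hs
    match s with
    | [] => simp [boundedStrings]
    | true :: s => simpa [boundedStrings] using ih (by simpa using hs)
    | false :: s => simpa [boundedStrings] using ih (by simpa using hs)

theorem sum_boundedStrings_succ (n : ℕ) (f : List Bool → ℝ) :
    ∑ s ∈ boundedStrings (n + 1), f s =
      f [] + (∑ s ∈ boundedStrings n, f (true :: s) + ∑ s ∈ boundedStrings n, f (false :: s)) := by
  rw [boundedStrings, Finset.sum_insert (by simp), Finset.sum_union,
    Finset.sum_image (fun _ _ _ _ h => (List.cons.inj h).2),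
    Finset.sum_image (fun _ _ _ _ h => (List.cons.inj h).2)]
  rw [Finset.disjoint_left]
  simp

theorem sum_traceWeightAux_le_one {O : Query → ℝ} (hO : IsOracle O) (T : Machine) (x : List Bool)
    (n : ℕ) : ∀ pre, ∑ s ∈ boundedStrings n,
      (if ∃ b, act T x (pre ++ s) = Part.some (Action.output b)
        then traceWeightAux T O x pre s else 0) ≤ 1 := by
  induction n with
  | zero =>
    intro pre
    simp only [boundedStrings, Finset.sum_singleton, traceWeightAux]
    split_ifs <;> norm_num
  | succ n ih =>
    intro pre
    have hcons : ∀ b, ∑ s ∈ boundedStrings n,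
        (if ∃ c, act T x (pre ++ b :: s) = Part.some (Action.output c)
          then traceWeightAux T O x pre (b :: s) else 0) ≤ stepProb T O x pre b := by
      intro b
      have := mul_le_mul_of_nonneg_left (ih (pre ++ [b])) (stepProb_nonneg hO T x pre b)
      rw [Finset.mul_sum, mul_one] at this
      refine le_trans (le_of_eq (Finset.sum_congr rfl fun s _ => ?_)) this
      rw [mul_ite, mul_zero, traceWeightAux_cons, List.append_assoc, List.singleton_append]
    rw [sum_boundedStrings_succ, List.append_nil]
    by_cases hout : ∃ b, act T x pre = Part.some (Action.output b)
    · obtain ⟨c, hc⟩ := hout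
      have h1 := hcons true
      have h2 := hcons false
      rw [stepProb_of_eq O hc] at h1 h2
      rw [if_pos ⟨c, hc⟩]
      simp only [bitProb] at h1 h2
      simp only [traceWeightAux] at h1 h2 ⊢
      linarith
    · rw [if_neg hout]
      linarith [hcons true, hcons false, stepProb_add_le_one T O x pre]

/-- The probability that `T` outputs `b` on input `x` after receiving at most `n` bits. -/
noncomputable def truncLam (T : Machine) (O : Query → ℝ) (x : List Bool) (n : ℕ) (b : Bool) : ℝ :=
  ∑ s ∈ boundedStrings n,
    if act T x s = Part.some (Action.output b) then traceWeightAux T O x [] s else 0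

theorem truncLam_add_le_one {O : Query → ℝ} (hO : IsOracle O) (T : Machine) (x : List Bool)
    (n : ℕ) : truncLam T O x n true + truncLam T O x n false ≤ 1 := by
  refine le_trans (le_of_eq ?_) (sum_traceWeightAux_le_one hO T x n [])
  unfold truncLam
  rw [← Finset.sum_add_distrib]
  refine Finset.sum_congr rfl fun s _ => ?_
  rw [List.nil_append]
  by_cases h1 : act T x s = Part.some (Action.output true)
  · simp [h1]
  · by_cases h0 : act T x s = Part.some (Action.output false)
    · simp [h0]
    · have : ¬∃ b, act T x s = Part.some (Action.output b) := by
        rintro ⟨_ | _, hb⟩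
        · exact h0 hb
        · exact h1 hb
      simp [h1, h0, this]

theorem continuous_stepProb {X : Type*} [TopologicalSpace X] {O : X → Query → ℝ}
    (hO : ∀ q, Continuous fun y => O y q) (T : Machine) (x pre : List Bool) (b : Bool) :
    Continuous fun y => stepProb T (O y) x pre b := by
  unfold stepProb
  split_ifs with h
  · cases (act T x pre).get h with
    | output c => exact continuous_const
    | flip => exact continuous_const
    | ask q =>
      cases b
      · exact continuous_const.sub (hO q)
      · simpa [bitProb] using hO q
  · exact continuous_const

theorem continuous_traceWeightAux {X : Type*} [TopologicalSpace X] {O : X → Query → ℝ}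
    (hO : ∀ q, Continuous fun y => O y q) (T : Machine) (x : List Bool) (s : List Bool) :
    ∀ pre, Continuous fun y => traceWeightAux T (O y) x pre s := by
  induction s with
  | nil => intro _; exact continuous_const
  | cons b s ih => intro pre; exact (continuous_stepProb hO T x pre b).mul (ih _)

theorem continuous_truncLam {X : Type*} [TopologicalSpace X] {O : X → Query → ℝ}
    (hO : ∀ q, Continuous fun y => O y q) (T : Machine) (x : List Bool) (n : ℕ) (b : Bool) :
    Continuous fun y => truncLam T (O y) x n b := by
  refine continuous_finsetSum _ fun s _ => ?_
  split_ifs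
  · exact continuous_traceWeightAux hO T x s []
  · exact continuous_const

/-- Some oracle satisfies the reflection conditions of finitely many queries, with the output
probabilities truncated to runs that receive at most `n` bits. -/
theorem exists_truncated_reflective (Q : Finset Query) (n : ℕ) :
    ∃ O : Query → ℝ, IsOracle O ∧ ∀ q ∈ Q,
      ((q.2.2 : ℝ) < truncLam q.1 O q.2.1 n true → O q = 1) ∧
      (1 - (q.2.2 : ℝ) < truncLam q.1 O q.2.1 n false → O q = 0) := by
  let O : (Q → ℝ) → Query → ℝ := fun y q => if h : q ∈ Q then y ⟨q, h⟩ else 0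
  have hcont : ∀ q, Continuous fun y => O y q := by
    intro q
    by_cases h : q ∈ Q
    · simpa [O, h] using continuous_apply (⟨q, h⟩ : Q)
    · simpa [O, h] using continuous_const
  let drift : (Q → ℝ) → Q → ℝ := fun y q =>
    (truncLam q.1.1 (O y) q.1.2.1 n true - q.1.2.2) +
      (1 - q.1.2.2 - truncLam q.1.1 (O y) q.1.2.1 n false)
  let F : (Q → ℝ) → Q → ℝ := fun y q => max 0 (min 1 (y q + drift y q))
  have hF : Continuous F := by
    refine continuous_pi fun q => continuous_const.max (continuous_const.min ?_)
    exact (continuous_apply q).add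
      (((continuous_truncLam hcont _ _ _ _).sub continuous_const).add
        (continuous_const.sub (continuous_truncLam hcont _ _ _ _)))
  obtain ⟨y, hy, hfix⟩ := exists_fixedPoint_unitCube hF.continuousOn
    (fun y _ => ⟨fun q => le_max_left _ _, fun q => max_le zero_le_one (min_le_left _ _)⟩)
  have hO : IsOracle (O y) := by
    intro q
    by_cases h : q ∈ Q
    · simpa [O, h] using ⟨hy.1 ⟨q, h⟩, hy.2 ⟨q, h⟩⟩
    · simp [O, h]
  refine ⟨O y, hO, fun q hq => ?_⟩
  have hOq : O y q = y ⟨q, hq⟩ := by simp [O, hq]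
  have hle := truncLam_add_le_one hO q.1 q.2.1 n
  have hfq : max 0 (min 1 (y ⟨q, hq⟩ + drift y ⟨q, hq⟩)) = y ⟨q, hq⟩ := congrFun hfix ⟨q, hq⟩
  have h0 : 0 ≤ y ⟨q, hq⟩ := hy.1 ⟨q, hq⟩
  have h1 : y ⟨q, hq⟩ ≤ 1 := hy.2 ⟨q, hq⟩
  have hdrift : drift y ⟨q, hq⟩ = (truncLam q.1 (O y) q.2.1 n true - q.2.2) +
      (1 - q.2.2 - truncLam q.1 (O y) q.2.1 n false) := rfl
  rw [hOq]
  constructor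
  · intro hp
    have hpos : 0 < drift y ⟨q, hq⟩ := by rw [hdrift]; linarith
    rcases max_cases 0 (min 1 (y ⟨q, hq⟩ + drift y ⟨q, hq⟩)) with h | h <;>
      rcases min_cases 1 (y ⟨q, hq⟩ + drift y ⟨q, hq⟩) with h' | h' <;> linarith
  · intro hp
    have hneg : drift y ⟨q, hq⟩ < 0 := by rw [hdrift]; linarith
    rcases max_cases 0 (min 1 (y ⟨q, hq⟩ + drift y ⟨q, hq⟩)) with h | h <;>
      rcases min_cases 1 (y ⟨q, hq⟩ + drift y ⟨q, hq⟩) with h' | h' <;> linarith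

end FiniteTruncation

section Coding

theorem encode_ofEncodableOfInfinite {α : Type*} [Encodable α] [Infinite α] (a : α) :
    (Denumerable.ofEncodableOfInfinite α).encode a =
      Nat.count (· ∈ Set.range (Encodable.encode : α → ℕ)) (Encodable.encode a) := by
  have h : (Denumerable.ofEncodableOfInfinite α).encode a =
      @List.countP ℕ (fun m => @decide (m ∈ Set.range (Encodable.encode : α → ℕ))
        (Encodable.decidableRangeEncode α m)) (List.range (Encodable.encode a)) := rfl
  rw [h, Nat.count_eq_card_filter_range, List.countP_eq_length_filter]
  have : List.filter (fun m => @decide (m ∈ Set.range (Encodable.encode : α → ℕ))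
      (Encodable.decidableRangeEncode α m)) (List.range (Encodable.encode a)) =
      List.filter (fun m => decide (m ∈ Set.range (Encodable.encode : α → ℕ)))
      (List.range (Encodable.encode a)) := by
    congr!
  rw [this]
  rfl

theorem encode_int_mod (z : ℤ) : Encodable.encode z % 2 = if 0 ≤ z then 0 else 1 := by
  cases z with
  | ofNat n =>
    have : Encodable.encode (Int.ofNat n) = 2 * n := rfl
    have h : (0 : ℤ) ≤ Int.ofNat n := Int.natCast_nonneg n
    rw [this, if_pos h]
    omega
  | negSucc n =>
    have : Encodable.encode (Int.negSucc n) = 2 * n + 1 := rfl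
    simp [this]

theorem encode_int_div (z : ℤ) : (Encodable.encode z + 1) / 2 = z.natAbs := by
  cases z with
  | ofNat n =>
    have : Encodable.encode (Int.ofNat n) = 2 * n := rfl
    rw [this, Int.ofNat_eq_natCast, Int.natAbs_natCast]
    omega
  | negSucc n =>
    have : Encodable.encode (Int.negSucc n) = 2 * n + 1 := rfl
    rw [this, Int.natAbs_negSucc]
    omega

theorem encode_rat (p : ℚ) :
    Encodable.encode p = Nat.pair (Encodable.encode p.num) p.den := rfl

theorem mem_range_encode_rat (m : ℕ) : m ∈ Set.range (Encodable.encode : ℚ → ℕ) ↔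
    0 < m.unpair.2 ∧ ((m.unpair.1 + 1) / 2).Coprime m.unpair.2 := by
  constructor
  · rintro ⟨p, rfl⟩
    rw [encode_rat, Nat.unpair_pair]
    dsimp only
    rw [encode_int_div]
    exact ⟨p.pos, p.reduced⟩
  · rintro ⟨hd, hc⟩
    obtain ⟨z, hz⟩ : ∃ z : ℤ, Encodable.encode z = m.unpair.1 :=
      ⟨Denumerable.ofNat ℤ m.unpair.1, Denumerable.encode_ofNat _⟩
    rw [← hz, encode_int_div] at hc
    refine ⟨⟨z, m.unpair.2, hd.ne', hc⟩, ?_⟩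
    rw [encode_rat]
    dsimp only
    rw [hz, Nat.pair_unpair]

theorem encode_query (q : Query) : Encodable.encode q =
    Nat.pair (Encodable.encode q.1) (Nat.pair (Encodable.encode q.2.1) (Encodable.encode q.2.2)) :=
  rfl

/-- The index of the string with code `m` in the enumeration of all strings. -/
noncomputable def stringRank (m : ℕ) : ℕ :=
  Nat.count (· ∈ Set.range (Encodable.encode : List Bool → ℕ)) m

/-- The index of the rational with code `m` in the enumeration of all rationals. -/
noncomputable def ratRank (m : ℕ) : ℕ :=
  Nat.count (· ∈ Set.range (Encodable.encode : ℚ → ℕ)) m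

/-- The index of the query with code `c` in the enumeration used by the machines. -/
noncomputable def queryRank (c : ℕ) : ℕ :=
  Nat.pair c.unpair.1 (Nat.pair (stringRank c.unpair.2.unpair.1) (ratRank c.unpair.2.unpair.2))

/-- The index of a query in the enumeration used by the machines. -/
def queryIndex (q : Query) : ℕ :=
  (inferInstance : Denumerable Query).encode q

theorem ofNat_queryIndex (q : Query) : Denumerable.ofNat Query (queryIndex q) = q :=
  Denumerable.ofNat_encode q

theorem queryIndex_ofNat (n : ℕ) : queryIndex (Denumerable.ofNat Query n) = n :=
  Denumerable.encode_ofNat n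

theorem queryRank_encode (q : Query) : queryRank (Encodable.encode q) = queryIndex q := by
  have h : queryIndex q = Nat.pair (Encodable.encode q.1)
    (Nat.pair ((Denumerable.ofEncodableOfInfinite (List Bool)).encode q.2.1)
      ((Denumerable.ofEncodableOfInfinite ℚ).encode q.2.2)) := rfl
  rw [h, encode_ofEncodableOfInfinite, encode_ofEncodableOfInfinite, encode_query]
  simp only [queryRank, Nat.unpair_pair, stringRank, ratRank]

end Coding

section PrimitiveRecursion

variable {α : Type} [Primcodable α]

theorem primrec_sum_range {f : α → ℕ → ℕ} {n : α → ℕ} (hf : Primrec₂ f) (hn : Primrec n) :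
    Primrec fun a => ∑ i ∈ Finset.range (n a), f a i := by
  refine (Primrec.nat_rec' (h := fun a p => p.2 + f a p.1) hn (Primrec.const 0)
    (Primrec.nat_add.comp (Primrec.snd.comp Primrec.snd)
      (hf.comp Primrec.fst (Primrec.fst.comp Primrec.snd)))).of_eq fun a => ?_
  induction n a with
  | zero => rfl
  | succ k ih => rw [Finset.sum_range_succ, ← ih]

theorem primrec_two_pow {f : α → ℕ} (hf : Primrec f) : Primrec fun a => 2 ^ f a := by
  refine (Primrec.nat_rec' (h := fun _ p => p.2 * 2) hf (Primrec.const 1)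
    (Primrec.nat_mul.comp (Primrec.snd.comp Primrec.snd) (Primrec.const 2))).of_eq fun a => ?_
  induction f a with
  | zero => rfl
  | succ k ih => rw [pow_succ, ← ih]

theorem primrec_count {p : ℕ → Prop} [DecidablePred p] (hp : PrimrecPred p) :
    Primrec (Nat.count p) := by
  refine (primrec_sum_range (f := fun _ i => if p i then 1 else 0)
    (Primrec.ite (hp.comp Primrec.snd) (Primrec.const 1) (Primrec.const 0)) Primrec.id).of_eq
    fun n => ?_
  rw [Nat.count_eq_card_filter_range, Finset.card_filter]
  rfl

theorem primrec_unpair_fst {f : α → ℕ} (hf : Primrec f) : Primrec fun a => (f a).unpair.1 :=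
  Primrec.fst.comp (Primrec.unpair.comp hf)

theorem primrec_unpair_snd {f : α → ℕ} (hf : Primrec f) : Primrec fun a => (f a).unpair.2 :=
  Primrec.snd.comp (Primrec.unpair.comp hf)

theorem primrecPred_forall_lt {R : ℕ → α → Prop} (hR : PrimrecRel R) {f : α → ℕ}
    (hf : Primrec f) : PrimrecPred fun a => ∀ i < f a, R i a :=
  (hR.forall_mem_list.comp (Primrec.list_range.comp hf) Primrec.id).of_eq (by simp)

theorem primrecPred_coprime {f g : α → ℕ} (hf : Primrec f) (hg : Primrec g) :
    PrimrecPred fun a => (f a).Coprime (g a) := by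
  have hrel : PrimrecRel fun (i : ℕ) (a : α) => f a % (i + 2) = 0 → g a % (i + 2) ≠ 0 := by
    have hmod : ∀ {h : α → ℕ}, Primrec h →
        PrimrecPred fun p : ℕ × α => h p.2 % (p.1 + 2) = 0 := fun hh =>
      Primrec.eq.comp (Primrec.nat_mod.comp (hh.comp Primrec.snd)
        (Primrec.nat_add.comp Primrec.fst (Primrec.const 2))) (Primrec.const 0)
    exact ((hmod hf).not.or (hmod hg).not).of_eq fun _ => imp_iff_not_or.symm
  refine (primrecPred_forall_lt hrel
    (Primrec.succ.comp (Primrec.nat_add.comp hf hg))).of_eq fun a => ?_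
  constructor
  · intro h
    by_contra hc
    have h1 := Nat.mod_eq_zero_of_dvd (Nat.gcd_dvd_left (f a) (g a))
    have h2 := Nat.mod_eq_zero_of_dvd (Nat.gcd_dvd_right (f a) (g a))
    rcases Nat.eq_zero_or_pos ((f a).gcd (g a)) with h0 | h0
    · obtain ⟨hf0, hg0⟩ := Nat.gcd_eq_zero_iff.1 h0
      exact h 0 (Nat.succ_pos _) (by simp [hf0]) (by simp [hg0])
    · have hle : (f a).gcd (g a) ≤ f a + g a := by
        rcases Nat.eq_zero_or_pos (f a) with hf0 | hf0
        · simp [hf0]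
        · exact (Nat.gcd_le_left _ hf0).trans (Nat.le_add_right _ _)
      have hne : (f a).gcd (g a) - 2 + 2 = (f a).gcd (g a) := by
        have : (f a).gcd (g a) ≠ 1 := hc
        omega
      exact h ((f a).gcd (g a) - 2) (by omega) (by rw [hne, h1]) (by rw [hne, h2])
  · intro h i _ hi hi'
    have := Nat.dvd_gcd (Nat.dvd_of_mod_eq_zero hi) (Nat.dvd_of_mod_eq_zero hi')
    rw [h.gcd_eq_one, Nat.dvd_one] at this
    omega

theorem primrecPred_mem_range_encode_rat :
    PrimrecPred fun m => m ∈ Set.range (Encodable.encode : ℚ → ℕ) := by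
  have h1 := primrec_unpair_fst Primrec.id
  have h2 := primrec_unpair_snd Primrec.id
  exact ((Primrec.nat_lt.comp (Primrec.const 0) h2).and (primrecPred_coprime
    (Primrec.nat_div.comp (Primrec.succ.comp h1) (Primrec.const 2)) h2)).of_eq
    fun m => (mem_range_encode_rat m).symm

theorem primrec_queryRank : Primrec queryRank := by
  have h := primrec_unpair_snd Primrec.id
  exact Primrec₂.natPair.comp (primrec_unpair_fst Primrec.id) (Primrec₂.natPair.comp
    ((primrec_count Primcodable.mem_range_encode).comp (primrec_unpair_fst h))
    ((primrec_count primrecPred_mem_range_encode_rat).comp (primrec_unpair_snd h)))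

end PrimitiveRecursion

section DigitTables

open Nat.Partrec (Code)

/-- The mass, in units of `2 ^ (-t)`, of the first `t` binary digits equal to `b` that the digit
table `D` assigns to the query with index `c`. -/
def digitMass (D : ℕ → ℕ) (t c b : ℕ) : ℕ :=
  ∑ i ∈ Finset.range t, if D (Nat.pair c i) = b then 2 ^ (t - 1 - i) else 0

/-- A lower approximation of `2 ^ t * stepProb` computed from a digit table in `t` steps. -/
def stepMass (D : ℕ → ℕ) (t : ℕ) (T : Code) (y : ℕ) (pre : List Bool) (b : Bool) : ℕ :=
  (Code.evaln t T (Nat.pair y (Encodable.encode pre))).elim 0 fun a =>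
    if a < 2 then 0 else if a = 2 then 2 ^ (t - 1) else digitMass D t (a - 3) b.toNat

/-- Extend a prefix by one bit and multiply its mass by the mass of that step. -/
def traceStep (D : ℕ → ℕ) (t : ℕ) (T : Code) (y : ℕ) (st : List Bool × ℕ) (b : Bool) :
    List Bool × ℕ :=
  (st.1 ++ [b], st.2 * stepMass D t T y st.1 b)

/-- A lower approximation of `2 ^ (t * s.length) * traceWeightAux`. -/
def traceMass (D : ℕ → ℕ) (t : ℕ) (T : Code) (y : ℕ) (pre s : List Bool) : ℕ :=
  (s.foldl (traceStep D t T y) (pre, 1)).2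

/-- A lower approximation of `2 ^ (t * t) * lam`. -/
def outMass (D : ℕ → ℕ) (t : ℕ) (T : Code) (y : ℕ) (b : Bool) : ℕ :=
  ∑ m ∈ Finset.range t, (Encodable.decode m : Option (List Bool)).elim 0 fun s =>
    if Encodable.encode s = m ∧ Code.evaln t T (Nat.pair y m) = some b.toNat then
      traceMass D t T y [] s * 2 ^ (t * (t - s.length)) else 0

/-- The positive part of the integer with code `z`. -/
def posCode (z : ℕ) : ℕ := if z % 2 = 0 then (z + 1) / 2 else 0

/-- The negative part of the integer with code `z`. -/
def negCode (z : ℕ) : ℕ := if z % 2 = 0 then 0 else (z + 1) / 2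

/-- The digit table `D` certifies in `t` steps that the machine of the query with code `c`
outputs `1` with probability exceeding the threshold. -/
def ExceedsTrue (D : ℕ → ℕ) (c t : ℕ) : Prop :=
  posCode c.unpair.2.unpair.2.unpair.1 * 2 ^ (t * t) <
    outMass D t (Denumerable.ofNat Code c.unpair.1) c.unpair.2.unpair.1 true *
      c.unpair.2.unpair.2.unpair.2 + negCode c.unpair.2.unpair.2.unpair.1 * 2 ^ (t * t)

/-- The digit table `D` certifies in `t` steps that the machine of the query with code `c`
outputs `0` with probability exceeding the complementary threshold. -/
def ExceedsFalse (D : ℕ → ℕ) (c t : ℕ) : Prop :=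
  (c.unpair.2.unpair.2.unpair.2 + negCode c.unpair.2.unpair.2.unpair.1) * 2 ^ (t * t) <
    outMass D t (Denumerable.ofNat Code c.unpair.1) c.unpair.2.unpair.1 false *
      c.unpair.2.unpair.2.unpair.2 + posCode c.unpair.2.unpair.2.unpair.1 * 2 ^ (t * t)

/-- The digit table `D` is seen in `t` steps to violate reflectivity at the `i`-th digit of the
query with code `c`. -/
def Refutes (D : ℕ → ℕ) (c i t : ℕ) : Prop :=
  (c.unpair.2.unpair.1 ∈ Set.range (Encodable.encode : List Bool → ℕ) ∧
    c.unpair.2.unpair.2 ∈ Set.range (Encodable.encode : ℚ → ℕ)) ∧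
  ((D (Nat.pair (queryRank c) i) = 0 ∧ ExceedsTrue D c t) ∨
    (D (Nat.pair (queryRank c) i) = 1 ∧ ExceedsFalse D c t))

/-- The digit table of a `j`-bit number, most significant bit first, with value `2` outside. -/
def bitTable (n j i : ℕ) : ℕ := if i < j then n / 2 ^ (j - 1 - i) % 2 else 2

/-- No initial segment of the `k`-bit table `n` is refuted by a check among the first `k`. -/
def Admissible (n k : ℕ) : Prop :=
  ∀ j < k + 1, ∀ w < k, ¬Refutes (bitTable (n / 2 ^ (k - j)) j)
    w.unpair.1 w.unpair.2.unpair.1 w.unpair.2.unpair.2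

section Primrec

variable {α : Type} [Primcodable α] {D : α → ℕ → ℕ} {t : α → ℕ} {T : α → Code} {y : α → ℕ}

theorem primrec_digitMass (hD : Primrec₂ D) (ht : Primrec t) {c b : α → ℕ} (hc : Primrec c)
    (hb : Primrec b) : Primrec fun a => digitMass (D a) (t a) (c a) (b a) := by
  refine primrec_sum_range (Primrec.ite (Primrec.eq.comp (hD.comp Primrec.fst
    (Primrec₂.natPair.comp (hc.comp Primrec.fst) Primrec.snd)) (hb.comp Primrec.fst))
    (primrec_two_pow (Primrec.nat_sub.comp (Primrec.nat_sub.comp (ht.comp Primrec.fst)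
      (Primrec.const 1)) Primrec.snd)) (Primrec.const 0)) ht

theorem primrec_evaln (ht : Primrec t) (hT : Primrec T) {m : α → ℕ} (hm : Primrec m) :
    Primrec fun a => Code.evaln (t a) (T a) (m a) :=
  Code.primrec_evaln.comp ((ht.pair hT).pair hm)

theorem primrec_option_elim_zero {β : Type} [Primcodable β] {o : α → Option β}
    {f : α → β → ℕ} (ho : Primrec o) (hf : Primrec₂ f) :
    Primrec fun a => (o a).elim 0 (f a) :=
  (Primrec.option_casesOn ho (Primrec.const 0) hf).of_eq fun a => by cases o a <;> rfl

theorem primrec_stepMass (hD : Primrec₂ D) (ht : Primrec t) (hT : Primrec T) (hy : Primrec y)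
    {s : α → List Bool} (hs : Primrec s) {b : α → Bool} (hb : Primrec b) :
    Primrec fun a => stepMass (D a) (t a) (T a) (y a) (s a) (b a) := by
  refine primrec_option_elim_zero (primrec_evaln ht hT
    (Primrec₂.natPair.comp hy (Primrec.encode.comp hs))) ?_
  refine Primrec.ite (Primrec.nat_lt.comp Primrec.snd (Primrec.const 2)) (Primrec.const 0)
    (Primrec.ite (Primrec.eq.comp Primrec.snd (Primrec.const 2))
      (primrec_two_pow (Primrec.nat_sub.comp (ht.comp Primrec.fst) (Primrec.const 1)))
      (primrec_digitMass (D := fun p => D p.1) (hD.comp (Primrec.fst.comp Primrec.fst) Primrec.snd)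
        (ht.comp Primrec.fst) (Primrec.nat_sub.comp Primrec.snd (Primrec.const 3))
        ((Primrec.dom_bool Bool.toNat).comp (hb.comp Primrec.fst))))

theorem primrec_traceMass (hD : Primrec₂ D) (ht : Primrec t) (hT : Primrec T) (hy : Primrec y)
    {s : α → List Bool} (hs : Primrec s) :
    Primrec fun a => traceMass (D a) (t a) (T a) (y a) [] (s a) := by
  refine Primrec.snd.comp (Primrec.list_foldl
    (h := fun a p => traceStep (D a) (t a) (T a) (y a) p.1 p.2) hs (Primrec.const ([], 1)) ?_)
  have h1 := Primrec.fst (α := α) (β := (List Bool × ℕ) × Bool)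
  have h2 := Primrec.fst.comp (Primrec.snd (α := α) (β := (List Bool × ℕ) × Bool))
  have h3 := Primrec.snd.comp (Primrec.snd (α := α) (β := (List Bool × ℕ) × Bool))
  exact (Primrec.list_concat.comp (Primrec.fst.comp h2) h3).pair
    (Primrec.nat_mul.comp (Primrec.snd.comp h2)
      (primrec_stepMass (D := fun p => D p.1) (hD.comp (h1.comp Primrec.fst) Primrec.snd)
        (ht.comp h1) (hT.comp h1) (hy.comp h1) (Primrec.fst.comp h2) h3))

theorem primrec_outMass (hD : Primrec₂ D) (ht : Primrec t) (hT : Primrec T) (hy : Primrec y)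
    (b : Bool) : Primrec fun a => outMass (D a) (t a) (T a) (y a) b := by
  have h1 := Primrec.fst.comp (Primrec.fst (α := α × ℕ) (β := List Bool))
  have h2 := Primrec.snd.comp (Primrec.fst (α := α × ℕ) (β := List Bool))
  have hc : PrimrecPred fun p : (α × ℕ) × List Bool => Encodable.encode p.2 = p.1.2 ∧
      Code.evaln (t p.1.1) (T p.1.1) (Nat.pair (y p.1.1) p.1.2) = some b.toNat :=
    PrimrecPred.and (Primrec.eq.comp (Primrec.encode.comp Primrec.snd) h2)
      (Primrec.eq.comp (primrec_evaln (ht.comp h1) (hT.comp h1)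
        (Primrec₂.natPair.comp (hy.comp h1) h2)) (Primrec.const _))
  have hm : Primrec fun p : (α × ℕ) × List Bool =>
      traceMass (D p.1.1) (t p.1.1) (T p.1.1) (y p.1.1) [] p.2 :=
    primrec_traceMass (D := fun p : (α × ℕ) × List Bool => D p.1.1)
      (hD.comp (h1.comp Primrec.fst) Primrec.snd) (ht.comp h1) (hT.comp h1) (hy.comp h1) Primrec.snd
  have hpow : Primrec fun p : (α × ℕ) × List Bool => 2 ^ (t p.1.1 * (t p.1.1 - p.2.length)) :=
    primrec_two_pow (Primrec.nat_mul.comp (ht.comp h1)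
      (Primrec.nat_sub.comp (ht.comp h1) (Primrec.list_length.comp Primrec.snd)))
  exact primrec_sum_range (primrec_option_elim_zero (Primrec.decode.comp Primrec.snd)
    (Primrec.ite hc (Primrec.nat_mul.comp hm hpow) (Primrec.const 0))) ht

theorem primrec_posCode : Primrec posCode :=
  Primrec.ite (Primrec.eq.comp (Primrec.nat_mod.comp Primrec.id (Primrec.const 2))
    (Primrec.const 0)) (Primrec.nat_div.comp (Primrec.succ) (Primrec.const 2)) (Primrec.const 0)

theorem primrec_negCode : Primrec negCode :=
  Primrec.ite (Primrec.eq.comp (Primrec.nat_mod.comp Primrec.id (Primrec.const 2))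
    (Primrec.const 0)) (Primrec.const 0) (Primrec.nat_div.comp (Primrec.succ) (Primrec.const 2))

theorem primrecPred_refutes (hD : Primrec₂ D) {c i : α → ℕ} (hc : Primrec c) (hi : Primrec i)
    (ht : Primrec t) : PrimrecPred fun a => Refutes (D a) (c a) (i a) (t a) := by
  have hT := (Primrec.ofNat Code).comp (primrec_unpair_fst hc)
  have hxp := primrec_unpair_snd hc
  have hy := primrec_unpair_fst hxp
  have hp := primrec_unpair_snd hxp
  have hz := primrec_unpair_fst hp
  have hd := primrec_unpair_snd hp
  have hpos := primrec_posCode.comp hz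
  have hneg := primrec_negCode.comp hz
  have htt := primrec_two_pow (Primrec.nat_mul.comp ht ht)
  have hdig := hD.comp Primrec.id (Primrec₂.natPair.comp (primrec_queryRank.comp hc) hi)
  have htrue : PrimrecPred fun a => ExceedsTrue (D a) (c a) (t a) :=
    Primrec.nat_lt.comp (Primrec.nat_mul.comp hpos htt) (Primrec.nat_add.comp
      (Primrec.nat_mul.comp (primrec_outMass hD ht hT hy true) hd) (Primrec.nat_mul.comp hneg htt))
  have hfalse : PrimrecPred fun a => ExceedsFalse (D a) (c a) (t a) :=
    Primrec.nat_lt.comp (Primrec.nat_mul.comp (Primrec.nat_add.comp hd hneg) htt)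
      (Primrec.nat_add.comp (Primrec.nat_mul.comp (primrec_outMass hD ht hT hy false) hd)
        (Primrec.nat_mul.comp hpos htt))
  exact PrimrecPred.and (PrimrecPred.and (Primcodable.mem_range_encode.comp hy)
    (primrecPred_mem_range_encode_rat.comp hp))
    (PrimrecPred.or (PrimrecPred.and (Primrec.eq.comp hdig (Primrec.const 0)) htrue)
      (PrimrecPred.and (Primrec.eq.comp hdig (Primrec.const 1)) hfalse))

theorem primrec_bitTable {n j i : α → ℕ} (hn : Primrec n) (hj : Primrec j) (hi : Primrec i) :
    Primrec fun a => bitTable (n a) (j a) (i a) :=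
  Primrec.ite (Primrec.nat_lt.comp hi hj) (Primrec.nat_mod.comp (Primrec.nat_div.comp hn
    (primrec_two_pow (Primrec.nat_sub.comp (Primrec.nat_sub.comp hj (Primrec.const 1)) hi)))
    (Primrec.const 2)) (Primrec.const 2)

theorem primrecRel_admissible : PrimrecRel Admissible := by
  refine primrecPred_forall_lt (R := fun j (p : ℕ × ℕ) => ∀ w < p.2, ¬Refutes
    (bitTable (p.1 / 2 ^ (p.2 - j)) j) w.unpair.1 w.unpair.2.unpair.1 w.unpair.2.unpair.2)
    ?_ (Primrec.succ.comp Primrec.snd)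
  refine primrecPred_forall_lt (R := fun w (p : ℕ × ℕ × ℕ) => ¬Refutes
    (bitTable (p.2.1 / 2 ^ (p.2.2 - p.1)) p.1) w.unpair.1 w.unpair.2.unpair.1
      w.unpair.2.unpair.2) ?_ (Primrec.snd.comp Primrec.snd)
  have hw := Primrec.fst (α := ℕ) (β := ℕ × ℕ × ℕ)
  have hp := Primrec.snd (α := ℕ) (β := ℕ × ℕ × ℕ)
  have hj : Primrec fun p : ℕ × ℕ × ℕ × ℕ => p.2.1 := Primrec.fst.comp hp
  have hn : Primrec fun p : ℕ × ℕ × ℕ × ℕ => p.2.2.1 := Primrec.fst.comp (Primrec.snd.comp hp)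
  have hk : Primrec fun p : ℕ × ℕ × ℕ × ℕ => p.2.2.2 := Primrec.snd.comp (Primrec.snd.comp hp)
  have hn' : Primrec fun p : ℕ × ℕ × ℕ × ℕ => p.2.2.1 / 2 ^ (p.2.2.2 - p.2.1) :=
    Primrec.nat_div.comp hn (primrec_two_pow (Primrec.nat_sub.comp hk hj))
  have hD : Primrec₂ fun p : ℕ × ℕ × ℕ × ℕ => bitTable (p.2.2.1 / 2 ^ (p.2.2.2 - p.2.1)) p.2.1 :=
    primrec_bitTable (hn'.comp Primrec.fst) (hj.comp Primrec.fst) Primrec.snd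
  exact (primrecPred_refutes hD (primrec_unpair_fst hw)
    (primrec_unpair_fst (primrec_unpair_snd hw))
    (primrec_unpair_snd (primrec_unpair_snd hw))).not

end Primrec

end DigitTables

section Approximation

open Nat.Partrec (Code)
open Filter Topology

theorem act_of_evaln {t : ℕ} {T : Code} {x s : List Bool} {a : ℕ}
    (h : Code.evaln t T (Nat.pair (Encodable.encode x) (Encodable.encode s)) = some a) :
    act T x s = Part.some (decodeAction a) := by
  rw [act, Part.eq_some_iff.2 (Code.evaln_sound h), Part.map_some]

theorem decodeAction_eq_output {a : ℕ} {b : Bool} :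
    decodeAction a = Action.output b ↔ a = b.toNat := by
  match a, b with
  | 0, true => simp [decodeAction]
  | 0, false => simp [decodeAction]
  | 1, true => simp [decodeAction]
  | 1, false => simp [decodeAction]
  | 2, true => simp [decodeAction]
  | 2, false => simp [decodeAction]
  | _ + 3, true => simp [decodeAction]
  | _ + 3, false => simp [decodeAction]

theorem eventually_evaln {T : Code} {m a : ℕ} (h : a ∈ T.eval m) :
    ∀ᶠ t in atTop, Code.evaln t T m = some a := by
  obtain ⟨k, hk⟩ := Code.evaln_complete.1 h
  exact eventually_atTop.2 ⟨k, fun t ht => Code.evaln_mono ht hk⟩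

theorem traceMass_cons (D : ℕ → ℕ) (t : ℕ) (T : Code) (y : ℕ) (pre : List Bool) (b : Bool)
    (s : List Bool) : traceMass D t T y pre (b :: s) =
      stepMass D t T y pre b * traceMass D t T y (pre ++ [b]) s := by
  have h : ∀ (s : List Bool) (pre : List Bool) (m : ℕ),
      (s.foldl (traceStep D t T y) (pre, m)).2 = m * traceMass D t T y pre s := by
    intro s
    induction s with
    | nil => intro pre m; exact (mul_one m).symm
    | cons b s ih =>
      intro pre m
      rw [traceMass, List.foldl_cons, List.foldl_cons, traceStep, traceStep, ih, ih]
      ring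
  rw [traceMass, List.foldl_cons, traceStep, h, one_mul]

/-- The strings whose code is less than `t`. -/
noncomputable def shortStrings (t : ℕ) : Finset (List Bool) :=
  (Finset.range t).preimage Encodable.encode Encodable.encode_injective.injOn

theorem mem_shortStrings {t : ℕ} {s : List Bool} :
    s ∈ shortStrings t ↔ Encodable.encode s < t := by
  simp [shortStrings]

theorem length_lt_of_mem_shortStrings {t : ℕ} {s : List Bool} (h : s ∈ shortStrings t) :
    s.length < t :=
  (Encodable.length_le_encode s).trans_lt (mem_shortStrings.1 h)

theorem outMass_eq (D : ℕ → ℕ) (t : ℕ) (T : Code) (y : ℕ) (b : Bool) :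
    outMass D t T y b = ∑ s ∈ shortStrings t,
      if Code.evaln t T (Nat.pair y (Encodable.encode s)) = some b.toNat then
        traceMass D t T y [] s * 2 ^ (t * (t - s.length)) else 0 := by
  rw [outMass]
  refine ((Finset.sum_congr rfl fun s _ => ?_).trans (Finset.sum_preimage Encodable.encode
    (Finset.range t) (Encodable.encode_injective (α := List Bool)).injOn _ ?_)).symm
  · rw [Encodable.encodek, Option.elim_some]
    simp only [true_and]
  · intro m _ hm
    cases hs : (Encodable.decode m : Option (List Bool)) with
    | none => rfl
    | some s => rw [Option.elim_some, if_neg fun h => hm ⟨s, h.1⟩]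

/-- The digit table `D` assigns to every oracle answer at most the probability it has in `O`. -/
def Underestimates (D : ℕ → ℕ) (t : ℕ) (O : Query → ℝ) : Prop :=
  ∀ c b, (digitMass D t c b.toNat : ℝ) ≤ 2 ^ t * bitProb O (.ask (Denumerable.ofNat Query c)) b

section Underestimates

variable {D : ℕ → ℕ} {t : ℕ} {O : Query → ℝ} (hO : IsOracle O) (hD : Underestimates D t O)
include hO hD

theorem stepMass_le (T : Code) (x pre : List Bool) (b : Bool) :
    (stepMass D t T (Encodable.encode x) pre b : ℝ) ≤ 2 ^ t * stepProb T O x pre b := by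
  unfold stepMass
  cases h : Code.evaln t T (Nat.pair (Encodable.encode x) (Encodable.encode pre)) with
  | none =>
    rw [Option.elim_none, Nat.cast_zero]
    exact mul_nonneg (by positivity) (stepProb_nonneg hO _ _ _ _)
  | some a =>
    rw [Option.elim_some, stepProb_of_eq O (act_of_evaln h)]
    match a with
    | 0 => simp [decodeAction, bitProb]
    | 1 => simp [decodeAction, bitProb]
    | 2 =>
      cases t with
      | zero => simp [Code.evaln] at h
      | succ t => simp [decodeAction, bitProb, pow_succ]
    | a + 3 => simpa [decodeAction] using hD a b

theorem traceMass_le (T : Code) (x s : List Bool) : ∀ pre,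
    (traceMass D t T (Encodable.encode x) pre s : ℝ) ≤
      2 ^ (t * s.length) * traceWeightAux T O x pre s := by
  induction s with
  | nil => intro pre; simp [traceMass, traceWeightAux]
  | cons b s ih =>
    intro pre
    rw [traceMass_cons, traceWeightAux_cons, Nat.cast_mul, List.length_cons, mul_add_one, pow_add,
      mul_comm (2 ^ _ : ℝ), mul_mul_mul_comm]
    exact mul_le_mul (stepMass_le hO hD T x pre b) (ih _) (Nat.cast_nonneg _)
      (mul_nonneg (by positivity) (stepProb_nonneg hO _ _ _ _))

theorem outMass_le (T : Code) (x : List Bool) (b : Bool) {n : ℕ} (hn : t ≤ n) :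
    (outMass D t T (Encodable.encode x) b : ℝ) ≤ 2 ^ (t * t) * truncLam T O x n b := by
  rw [outMass_eq, truncLam, Finset.mul_sum, Nat.cast_sum]
  refine (Finset.sum_le_sum fun s hs => ?_).trans (Finset.sum_le_sum_of_subset_of_nonneg
    (s := shortStrings t) (fun s hs => mem_boundedStrings
      ((length_lt_of_mem_shortStrings hs).le.trans hn)) fun s _ _ => ?_)
  · split_ifs with h1 h2 h2
    · rw [Nat.cast_mul, Nat.cast_pow, Nat.cast_ofNat]
      refine (mul_le_mul_of_nonneg_right (traceMass_le hO hD T x s []) (by positivity)).trans_eq ?_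
      rw [mul_right_comm, ← pow_add, ← mul_add,
        Nat.add_sub_cancel' (length_lt_of_mem_shortStrings hs).le]
    · exact absurd ((act_of_evaln h1).trans (by rw [decodeAction_eq_output.2 rfl])) h2
    · rw [Nat.cast_zero]
      exact mul_nonneg (by positivity) (traceWeightAux_nonneg hO _ _ _ _)
    · simp
  · split_ifs
    · exact mul_nonneg (by positivity) (traceWeightAux_nonneg hO _ _ _ _)
    · simp

end Underestimates

section Convergence

variable {D : ℕ → ℕ → ℕ} {t : ℕ → ℕ} {O : Query → ℝ} (ht : Tendsto t atTop atTop)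
  (hD : ∀ c b, Tendsto (fun j => (digitMass (D j) (t j) c b.toNat : ℝ) / 2 ^ t j) atTop
    (𝓝 (bitProb O (.ask (Denumerable.ofNat Query c)) b)))
include ht hD

theorem tendsto_stepMass (T : Code) (x pre : List Bool) (b : Bool) :
    Tendsto (fun j => (stepMass (D j) (t j) T (Encodable.encode x) pre b : ℝ) / 2 ^ t j) atTop
      (𝓝 (stepProb T O x pre b)) := by
  by_cases hdom : (act T x pre).Dom
  · obtain ⟨a, ha⟩ := Part.dom_iff_mem.1 (show (T.eval _).Dom from hdom)
    have hact : act T x pre = Part.some (decodeAction a) := by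
      rw [act, Part.eq_some_iff.2 ha, Part.map_some]
    have hev := ht.eventually ((eventually_evaln ha).and (eventually_ge_atTop 1))
    rw [stepProb_of_eq O hact]
    suffices h : Tendsto (fun j => ((if a < 2 then 0 else if a = 2 then 2 ^ (t j - 1) else
        digitMass (D j) (t j) (a - 3) b.toNat : ℕ) : ℝ) / 2 ^ t j) atTop
        (𝓝 (bitProb O (decodeAction a) b)) ∨ a = 2 by
      rcases h with h | rfl
      · refine h.congr' (hev.mono fun j hj => ?_)
        simp only [stepMass, hj.1, Option.elim_some]
      · refine tendsto_const_nhds.congr' (hev.mono fun j hj => ?_)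
        obtain ⟨k, hk⟩ := Nat.exists_eq_add_of_le' hj.2
        rw [hk] at hj
        simp [stepMass, hj.1, hk, decodeAction, bitProb, pow_succ]
        field_simp
    match a with
    | 0 => left; simp [decodeAction, bitProb]
    | 1 => left; simp [decodeAction, bitProb]
    | 2 => right; rfl
    | a + 3 => left; simpa [decodeAction] using hD a b
  · have h0 : stepProb T O x pre b = 0 := dif_neg hdom
    rw [h0]
    refine tendsto_const_nhds.congr fun j => ?_
    cases h : Code.evaln (t j) T (Nat.pair (Encodable.encode x) (Encodable.encode pre)) with
    | none => simp [stepMass, h]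
    | some a => exact absurd (by rw [act_of_evaln h]; trivial) hdom

theorem tendsto_traceMass (T : Code) (x s : List Bool) : ∀ pre,
    Tendsto (fun j => (traceMass (D j) (t j) T (Encodable.encode x) pre s : ℝ) /
      2 ^ (t j * s.length)) atTop (𝓝 (traceWeightAux T O x pre s)) := by
  induction s with
  | nil => intro pre; simp [traceMass, traceWeightAux]
  | cons b s ih =>
    intro pre
    rw [traceWeightAux_cons]
    refine ((tendsto_stepMass ht hD T x pre b).mul (ih (pre ++ [b]))).congr fun j => ?_
    rw [traceMass_cons, Nat.cast_mul, List.length_cons, mul_add_one, pow_add,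
      mul_comm (2 ^ (_ * _) : ℝ), mul_div_mul_comm]

theorem eventually_lt_outMass {T : Code} {x : List Bool} {b : Bool} {r : ℝ}
    (hr : r < lam T O x b) :
    ∀ᶠ j in atTop, r * 2 ^ (t j * t j) < outMass (D j) (t j) T (Encodable.encode x) b := by
  obtain ⟨S, hS⟩ : ∃ S : Finset { s : List Bool // act T x s = Part.some (Action.output b) },
      r < ∑ s ∈ S, traceWeightAux T O x [] s.1 := by
    by_cases hsum : Summable fun s : { s : List Bool // act T x s = Part.some (Action.output b) } =>
        traceWeightAux T O x [] s.1
    · exact (hsum.hasSum.eventually (lt_mem_nhds hr)).exists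
    · rw [lam, tsum_eq_zero_of_not_summable hsum] at hr
      exact ⟨∅, by simpa using hr⟩
  have hlim := tendsto_finsetSum S fun s _ => tendsto_traceMass ht hD T x s.1 []
  have hev : ∀ᶠ j in atTop, ∀ s ∈ S, s.1 ∈ shortStrings (t j) ∧
      Code.evaln (t j) T (Nat.pair (Encodable.encode x) (Encodable.encode s.1)) =
        some b.toNat := by
    refine (eventually_all_finset S).2 fun s _ => ?_
    have hs := Part.eq_some_iff.1 s.2
    obtain ⟨a, ha, hab⟩ := (Part.mem_map_iff _).1 hs
    rw [decodeAction_eq_output] at hab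
    subst hab
    exact (ht.eventually ((eventually_gt_atTop _).and (eventually_evaln ha))).mono
      fun j hj => ⟨mem_shortStrings.2 hj.1, hj.2⟩
  filter_upwards [hlim.eventually (lt_mem_nhds hS), hev] with j hj hmem
  rw [← lt_div_iff₀ (by positivity)]
  refine hj.trans_le ?_
  rw [outMass_eq, Nat.cast_sum, Finset.sum_div]
  refine ((Finset.sum_map S (Function.Embedding.subtype _) fun s : List Bool =>
    (traceMass (D j) (t j) T (Encodable.encode x) [] s : ℝ) / 2 ^ (t j * s.length)).symm.trans_le ?_)
  have hmem' : ∀ s ∈ S.map (Function.Embedding.subtype _), s ∈ shortStrings (t j) ∧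
      Code.evaln (t j) T (Nat.pair (Encodable.encode x) (Encodable.encode s)) =
        some b.toNat := by
    intro s hs
    obtain ⟨s', hs', rfl⟩ := Finset.mem_map.1 hs
    exact hmem s' hs'
  refine (Finset.sum_le_sum fun s hs => ?_).trans (Finset.sum_le_sum_of_subset_of_nonneg
    (fun s hs => (hmem' s hs).1) fun s _ _ => by positivity)
  obtain ⟨h1, h2⟩ := hmem' s hs
  rw [if_pos h2, Nat.cast_mul, Nat.cast_pow, Nat.cast_ofNat]
  refine le_of_eq ?_
  rw [div_eq_div_iff (by positivity) (by positivity), mul_assoc, ← pow_add, ← mul_add,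
    Nat.sub_add_cancel (length_lt_of_mem_shortStrings h1).le]

end Convergence

theorem cast_posCode (z : ℤ) :
    (posCode (Encodable.encode z) : ℝ) = z + negCode (Encodable.encode z) := by
  have h : ((posCode (Encodable.encode z) : ℕ) : ℤ) = z + negCode (Encodable.encode z) := by
    rw [posCode, negCode, encode_int_mod, encode_int_div]
    by_cases hz : 0 ≤ z
    · simp [hz]
    · simp only [hz, if_false, one_ne_zero]
      omega
  exact_mod_cast h

theorem exceedsTrue_iff (D : ℕ → ℕ) (q : Query) (t : ℕ) :
    ExceedsTrue D (Encodable.encode q) t ↔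
      (q.2.2 : ℝ) * 2 ^ (t * t) < outMass D t q.1 (Encodable.encode q.2.1) true := by
  have hd : (0 : ℝ) < q.2.2.den := Nat.cast_pos.2 q.2.2.pos
  rw [ExceedsTrue, encode_query, encode_rat]
  simp only [Nat.unpair_pair, Denumerable.ofNat_encode]
  have key : (q.2.2 : ℝ) * 2 ^ (t * t) * q.2.2.den = q.2.2.num * 2 ^ (t * t) := by
    rw [mul_right_comm, Rat.cast_def, div_mul_cancel₀ _ hd.ne']
  rw [← Nat.cast_lt (α := ℝ), ← mul_lt_mul_iff_left₀ (b := (q.2.2 : ℝ) * _) hd, key]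
  push_cast
  rw [cast_posCode]
  constructor <;> intro h <;> linarith

theorem exceedsFalse_iff (D : ℕ → ℕ) (q : Query) (t : ℕ) :
    ExceedsFalse D (Encodable.encode q) t ↔
      (1 - (q.2.2 : ℝ)) * 2 ^ (t * t) < outMass D t q.1 (Encodable.encode q.2.1) false := by
  have hd : (0 : ℝ) < q.2.2.den := Nat.cast_pos.2 q.2.2.pos
  rw [ExceedsFalse, encode_query, encode_rat]
  simp only [Nat.unpair_pair, Denumerable.ofNat_encode]
  have key : (1 - (q.2.2 : ℝ)) * 2 ^ (t * t) * q.2.2.den =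
      q.2.2.den * 2 ^ (t * t) - q.2.2.num * 2 ^ (t * t) := by
    rw [mul_right_comm, Rat.cast_def, sub_mul, div_mul_cancel₀ _ hd.ne', one_mul, sub_mul]
  rw [← Nat.cast_lt (α := ℝ), ← mul_lt_mul_iff_left₀ (b := (1 - (q.2.2 : ℝ)) * _) hd, key]
  push_cast
  rw [cast_posCode]
  constructor <;> intro h <;> linarith

theorem refutes_encode_iff (D : ℕ → ℕ) (q : Query) (i t : ℕ) :
    Refutes D (Encodable.encode q) i t ↔
      (D (Nat.pair (queryIndex q) i) = 0 ∧
        (q.2.2 : ℝ) * 2 ^ (t * t) < outMass D t q.1 (Encodable.encode q.2.1) true) ∨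
      (D (Nat.pair (queryIndex q) i) = 1 ∧
        (1 - (q.2.2 : ℝ)) * 2 ^ (t * t) < outMass D t q.1 (Encodable.encode q.2.1) false) := by
  rw [← exceedsTrue_iff, ← exceedsFalse_iff, ← queryRank_encode, Refutes]
  refine and_iff_right ?_
  rw [encode_query]
  simp only [Nat.unpair_pair]
  exact ⟨⟨_, rfl⟩, ⟨_, rfl⟩⟩

theorem exists_query_of_refutes {D : ℕ → ℕ} {c i t : ℕ} (h : Refutes D c i t) :
    ∃ q : Query, Encodable.encode q = c := by
  obtain ⟨⟨x, hx⟩, ⟨p, hp⟩⟩ := h.1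
  refine ⟨(Denumerable.ofNat Code c.unpair.1, x, p), ?_⟩
  rw [encode_query]
  simp only [hx, hp, Denumerable.encode_ofNat, Nat.pair_unpair]

end Approximation

section Digits

/-- The `i`-th binary digit of a real number in the unit interval. -/
noncomputable def binaryDigit : ℝ → ℕ → ℕ
  | v, 0 => if 1 / 2 ≤ v then 1 else 0
  | v, i + 1 => binaryDigit (if 1 / 2 ≤ v then 2 * v - 1 else 2 * v) i

theorem binaryDigit_lt_two (i : ℕ) : ∀ v, binaryDigit v i < 2 := by
  induction i with
  | zero => intro v; unfold binaryDigit; split_ifs <;> norm_num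
  | succ i ih => intro v; exact ih _

theorem binaryDigit_one (i : ℕ) : binaryDigit 1 i = 1 := by
  induction i with
  | zero => norm_num [binaryDigit]
  | succ i ih => rw [binaryDigit]; norm_num [ih]

theorem binaryDigit_zero (i : ℕ) : binaryDigit 0 i = 0 := by
  induction i with
  | zero => norm_num [binaryDigit]
  | succ i ih => rw [binaryDigit]; norm_num [ih]

theorem sum_binaryDigit_le (t : ℕ) : ∀ v : ℝ, 0 ≤ v → v ≤ 1 →
    ((∑ i ∈ Finset.range t, if binaryDigit v i = 1 then 2 ^ (t - 1 - i) else 0 : ℕ) : ℝ) ≤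
        2 ^ t * v ∧
      ((∑ i ∈ Finset.range t, if binaryDigit v i = 0 then 2 ^ (t - 1 - i) else 0 : ℕ) : ℝ) ≤
        2 ^ t * (1 - v) := by
  induction t with
  | zero => intro v h0 h1; simp [h0, h1]
  | succ t ih =>
    intro v h0 h1
    have hexp : ∀ i, t + 1 - 1 - (i + 1) = t - 1 - i := fun i => by omega
    simp only [Finset.sum_range_succ', hexp, Nat.cast_add]
    by_cases hv : 1 / 2 ≤ v
    · obtain ⟨h2, h3⟩ := ih (2 * v - 1) (by linarith) (by linarith)
      simp only [binaryDigit, if_pos hv]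
      norm_num at h2 h3 ⊢
      rw [pow_succ]
      constructor <;> linarith
    · obtain ⟨h2, h3⟩ := ih (2 * v) (by linarith) (by linarith)
      simp only [binaryDigit, if_neg hv]
      norm_num at h2 h3 ⊢
      rw [pow_succ]
      constructor <;> linarith

/-- The number whose `k` binary digits are the first `k` values of `d`. -/
def prefixValue (d : ℕ → ℕ) : ℕ → ℕ
  | 0 => 0
  | k + 1 => 2 * prefixValue d k + d k

variable {d : ℕ → ℕ} (hd : ∀ i, d i < 2)
include hd

theorem prefixValue_lt (k : ℕ) : prefixValue d k < 2 ^ k := by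
  induction k with
  | zero => exact Nat.one_pos
  | succ k ih =>
    have := hd k
    rw [prefixValue, pow_succ]
    omega

theorem prefixValue_add_div (j l : ℕ) : prefixValue d (j + l) / 2 ^ l = prefixValue d j := by
  induction l with
  | zero => simp
  | succ l ih =>
    have := hd (j + l)
    rw [pow_succ', ← Nat.div_div_eq_div_mul, ← add_assoc, prefixValue]
    rw [show (2 * prefixValue d (j + l) + d (j + l)) / 2 = prefixValue d (j + l) by omega, ih]

theorem prefixValue_div {j k : ℕ} (h : j ≤ k) :
    prefixValue d k / 2 ^ (k - j) = prefixValue d j := by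
  obtain ⟨l, rfl⟩ := Nat.exists_eq_add_of_le h
  rw [Nat.add_sub_cancel_left, prefixValue_add_div hd]

theorem bitTable_prefixValue (k i : ℕ) :
    bitTable (prefixValue d k) k i = if i < k then d i else 2 := by
  unfold bitTable
  split_ifs with h
  · rw [Nat.sub_sub, add_comm 1 i, prefixValue_div hd h, prefixValue]
    have := hd i
    omega
  · rfl

theorem digitMass_prefixValue_le (k t c : ℕ) (b : Bool) :
    digitMass (bitTable (prefixValue d k) k) t c b.toNat ≤
      ∑ i ∈ Finset.range t, if d (Nat.pair c i) = b.toNat then 2 ^ (t - 1 - i) else 0 := by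
  refine Finset.sum_le_sum fun i _ => ?_
  rw [bitTable_prefixValue hd]
  by_cases h : Nat.pair c i < k
  · rw [if_pos h]
  · rw [if_neg h, if_neg]
    · exact Nat.zero_le _
    · cases b <;> simp

end Digits

section Soundness

theorem exists_admissible (k : ℕ) : ∃ n < 2 ^ k, Admissible n k := by
  let Q : Finset Query := (Finset.range k).preimage Encodable.encode
    Encodable.encode_injective.injOn
  obtain ⟨O, hO, hQ⟩ := exists_truncated_reflective Q k
  let d : ℕ → ℕ := fun m => binaryDigit (O (Denumerable.ofNat Query m.unpair.1)) m.unpair.2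
  have hd : ∀ i, d i < 2 := fun i => binaryDigit_lt_two _ _
  have hdq : ∀ q i, d (Nat.pair (queryIndex q) i) = binaryDigit (O q) i := fun q i => by
    simp only [d, Nat.unpair_pair, ofNat_queryIndex]
  refine ⟨prefixValue d k, prefixValue_lt hd k, fun j hj w hw href => ?_⟩
  rw [prefixValue_div hd (Nat.lt_succ_iff.1 hj)] at href
  set c := w.unpair.1
  set i := w.unpair.2.unpair.1
  set t := w.unpair.2.unpair.2
  have hc : c < k := (Nat.unpair_left_le w).trans_lt hw
  have ht : t ≤ k := (Nat.unpair_right_le _).trans ((Nat.unpair_right_le w).trans hw.le)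
  have hunder : Underestimates (bitTable (prefixValue d j) j) t O := by
    intro c b
    refine (Nat.cast_le.2 (digitMass_prefixValue_le hd j t c b)).trans ?_
    have := sum_binaryDigit_le t _ (hO (Denumerable.ofNat Query c)).1
      (hO (Denumerable.ofNat Query c)).2
    simp only [d, Nat.unpair_pair]
    cases b
    · simpa [bitProb] using this.2
    · simpa [bitProb] using this.1
  obtain ⟨q, hq⟩ := exists_query_of_refutes href
  have hqQ : q ∈ Q := by simpa [Q, hq] using hc
  have hpow : (0 : ℝ) < 2 ^ (t * t) := by positivity
  rw [← hq, refutes_encode_iff, bitTable_prefixValue hd, hdq] at href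
  rcases href with ⟨hbit, hlt⟩ | ⟨hbit, hlt⟩
  · have h := hlt.trans_le (outMass_le hO hunder q.1 q.2.1 true ht)
    rw [mul_comm, mul_lt_mul_iff_right₀ hpow] at h
    rw [(hQ q hqQ).1 h, binaryDigit_one] at hbit
    split_ifs at hbit
  · have h := hlt.trans_le (outMass_le hO hunder q.1 q.2.1 false ht)
    rw [mul_comm, mul_lt_mul_iff_right₀ hpow] at h
    rw [(hQ q hqQ).2 h, binaryDigit_zero] at hbit
    split_ifs at hbit
    omega

end Soundness

section LimitOracle

open Filter Topology

/-- The probability of `b` according to an infinite sequence of binary digits. -/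
noncomputable def digitValue (x : ℕ → ℕ) (b : ℕ) : ℝ :=
  ∑' i, if x i = b then (1 / 2 : ℝ) ^ (i + 1) else 0

theorem hasSum_half_pow_succ : HasSum (fun i : ℕ => (1 / 2 : ℝ) ^ (i + 1)) 1 := by
  simpa [pow_succ] using hasSum_geometric_two.mul_right (1 / 2 : ℝ)

theorem summable_digitValue (x : ℕ → ℕ) (b : ℕ) :
    Summable fun i => if x i = b then (1 / 2 : ℝ) ^ (i + 1) else 0 := by
  refine hasSum_half_pow_succ.summable.of_nonneg_of_le (fun i => ?_) fun i => ?_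
  · split_ifs <;> positivity
  · split_ifs
    · exact le_rfl
    · positivity

theorem digitValue_nonneg (x : ℕ → ℕ) (b : ℕ) : 0 ≤ digitValue x b :=
  tsum_nonneg fun i => by split_ifs <;> positivity

theorem digitValue_add {x : ℕ → ℕ} (hx : ∀ i, x i < 2) : digitValue x 1 + digitValue x 0 = 1 := by
  rw [digitValue, digitValue, ← (summable_digitValue x 1).tsum_add (summable_digitValue x 0)]
  refine (tsum_congr fun i => ?_).trans hasSum_half_pow_succ.tsum_eq
  have := hx i
  rcases (by omega : x i = 0 ∨ x i = 1) with h | h <;> simp [h]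

theorem tendsto_digitMass {D : ℕ → ℕ → ℕ} {c : ℕ} {x : ℕ → ℕ}
    (h : ∀ i, ∀ᶠ k in atTop, D k (Nat.pair c i) = x i) (b : ℕ) :
    Tendsto (fun k => (digitMass (D k) k c b : ℝ) / 2 ^ k) atTop (𝓝 (digitValue x b)) := by
  have hmass : ∀ k, (digitMass (D k) k c b : ℝ) / 2 ^ k =
      ∑' i, if i < k ∧ D k (Nat.pair c i) = b then (1 / 2 : ℝ) ^ (i + 1) else 0 := by
    intro k
    rw [tsum_eq_sum (s := Finset.range k), digitMass, Nat.cast_sum, Finset.sum_div]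
    · refine Finset.sum_congr rfl fun i hi => ?_
      have hik := Finset.mem_range.1 hi
      by_cases hb : D k (Nat.pair c i) = b
      · rw [if_pos hb, if_pos ⟨hik, hb⟩, Nat.cast_pow, Nat.cast_ofNat, one_div, inv_pow,
          div_eq_iff (by positivity), eq_inv_mul_iff_mul_eq₀ (by positivity), ← pow_add]
        congr 1
        omega
      · rw [if_neg hb, if_neg fun h => hb h.2, Nat.cast_zero, zero_div]
    · intro i hi
      exact if_neg fun h => hi (Finset.mem_range.2 h.1)
  simp only [hmass]
  refine tendsto_tsum_of_dominated_convergence hasSum_half_pow_succ.summable (fun i => ?_)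
    (Eventually.of_forall fun k i => ?_)
  · refine tendsto_const_nhds.congr' ?_
    filter_upwards [h i, eventually_gt_atTop i] with k hk hik
    simp [hk, hik]
  · split_ifs
    · rw [Real.norm_of_nonneg (by positivity)]
    · rw [norm_zero]
      positivity

theorem admissible_div_two {n k : ℕ} (h : Admissible n (k + 1)) : Admissible (n / 2) k := by
  intro j hj w hw
  have := h j (by omega) w (by omega)
  rwa [Nat.div_div_eq_div_mul, ← pow_succ', ← Nat.sub_add_comm (Nat.lt_succ_iff.1 hj)]

/-- The greatest admissible table with `k` bits. -/
noncomputable def greatestAdmissible (k : ℕ) : ℕ :=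
  Nat.findGreatest (fun n => Admissible n k) (2 ^ k - 1)

theorem greatestAdmissible_lt (k : ℕ) : greatestAdmissible k < 2 ^ k := by
  have := Nat.findGreatest_le (P := fun n => Admissible n k) (2 ^ k - 1)
  have := Nat.two_pow_pos k
  unfold greatestAdmissible
  omega

theorem admissible_greatestAdmissible (k : ℕ) : Admissible (greatestAdmissible k) k := by
  obtain ⟨n, hn, h⟩ := exists_admissible k
  exact Nat.findGreatest_spec (P := fun n => Admissible n k) (Nat.le_sub_one_of_lt hn) h

theorem greatestAdmissible_succ_div_le (k : ℕ) :
    greatestAdmissible (k + 1) / 2 ≤ greatestAdmissible k := by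
  refine Nat.le_findGreatest ?_ (admissible_div_two (admissible_greatestAdmissible (k + 1)))
  have := greatestAdmissible_lt (k + 1)
  rw [pow_succ] at this
  omega

/-- The eventual value of the first `j` bits of the greatest admissible tables. -/
noncomputable def limitPrefix (j : ℕ) : ℕ :=
  sInf (Set.range fun l => greatestAdmissible (j + l) / 2 ^ l)

theorem eventually_greatestAdmissible_div (j : ℕ) :
    ∀ᶠ k in atTop, greatestAdmissible k / 2 ^ (k - j) = limitPrefix j := by
  have hanti : Antitone fun l => greatestAdmissible (j + l) / 2 ^ l := by
    refine antitone_nat_of_succ_le fun l => ?_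
    rw [pow_succ', ← Nat.div_div_eq_div_mul]
    exact Nat.div_le_div_right (greatestAdmissible_succ_div_le (j + l))
  obtain ⟨N, hN⟩ := Nat.sInf_mem (Set.range_nonempty fun l => greatestAdmissible (j + l) / 2 ^ l)
  refine eventually_atTop.2 ⟨j + N, fun k hk => ?_⟩
  obtain ⟨l, rfl⟩ := Nat.exists_eq_add_of_le ((Nat.le_add_right j N).trans hk)
  rw [Nat.add_sub_cancel_left]
  exact le_antisymm ((hanti (by omega : N ≤ l)).trans_eq hN) (Nat.sInf_le ⟨l, rfl⟩)

/-- The limiting digit table. -/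
noncomputable def limitDigit (i : ℕ) : ℕ := limitPrefix (i + 1) % 2

theorem limitDigit_lt_two (i : ℕ) : limitDigit i < 2 := Nat.mod_lt _ two_pos

theorem limitPrefix_eq (j : ℕ) : limitPrefix j = prefixValue limitDigit j := by
  induction j with
  | zero =>
    obtain ⟨k, hk⟩ := (eventually_greatestAdmissible_div 0).exists
    rw [← hk, Nat.sub_zero, Nat.div_eq_of_lt (greatestAdmissible_lt k)]
    rfl
  | succ j ih =>
    obtain ⟨k, hk, hk', hjk⟩ := ((eventually_greatestAdmissible_div j).and
      ((eventually_greatestAdmissible_div (j + 1)).and (eventually_gt_atTop j))).exists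
    have : limitPrefix (j + 1) / 2 = limitPrefix j := by
      rw [← hk, ← hk', Nat.div_div_eq_div_mul, ← pow_succ]
      congr 2
      omega
    rw [prefixValue, ← ih, ← this, limitDigit]
    omega

theorem eventually_bitTable_greatestAdmissible (i : ℕ) :
    ∀ᶠ k in atTop, bitTable (greatestAdmissible k) k i = limitDigit i := by
  filter_upwards [eventually_greatestAdmissible_div (i + 1), eventually_gt_atTop i] with k hk hik
  rw [bitTable, if_pos hik, limitDigit, ← hk, Nat.sub_sub, add_comm 1 i]

theorem not_refutes_limitDigit (j c i t : ℕ) :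
    ¬Refutes (bitTable (prefixValue limitDigit j) j) c i t := by
  obtain ⟨k, hk, hjk, hwk⟩ := ((eventually_greatestAdmissible_div j).and
    ((eventually_ge_atTop j).and (eventually_gt_atTop (Nat.pair c (Nat.pair i t))))).exists
  have := admissible_greatestAdmissible k j (Nat.lt_succ_of_le hjk) _ hwk
  simpa only [hk, limitPrefix_eq, Nat.unpair_pair] using this

/-- The oracle described by the limiting digit table. -/
noncomputable def limitOracle (q : Query) : ℝ :=
  digitValue (fun i => limitDigit (Nat.pair (queryIndex q) i)) 1

theorem isOracle_limitOracle : IsOracle limitOracle := fun q => by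
  have h := digitValue_add fun i => limitDigit_lt_two (Nat.pair (queryIndex q) i)
  have h0 := digitValue_nonneg (fun i => limitDigit (Nat.pair (queryIndex q) i)) 0
  exact ⟨digitValue_nonneg _ _, by unfold limitOracle; linarith⟩

theorem eventually_bitTable_prefixValue (i : ℕ) :
    ∀ᶠ k in atTop, bitTable (prefixValue limitDigit k) k i = limitDigit i :=
  (eventually_gt_atTop i).mono fun k hk => by
    rw [bitTable_prefixValue limitDigit_lt_two, if_pos hk]

theorem tendsto_digitMass_limitDigit (c : ℕ) (b : Bool) :
    Tendsto (fun k => (digitMass (bitTable (prefixValue limitDigit k) k) k c b.toNat : ℝ) / 2 ^ k)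
      atTop (𝓝 (bitProb limitOracle (.ask (Denumerable.ofNat Query c)) b)) := by
  have h := tendsto_digitMass (c := c) (fun i => eventually_bitTable_prefixValue (Nat.pair c i))
    b.toNat
  convert h using 2
  cases b
  · have := digitValue_add fun i => limitDigit_lt_two (Nat.pair c i)
    simp only [bitProb, limitOracle, queryIndex_ofNat, Bool.toNat_false]
    simp only [Bool.false_eq_true, if_false]
    linarith
  · simp only [bitProb, limitOracle, queryIndex_ofNat, Bool.toNat_true, if_true]

theorem reflective_limitOracle : Reflective limitOracle := by
  refine ⟨isOracle_limitOracle, fun T x p => ⟨fun h => ?_, fun h => ?_⟩⟩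
  · by_contra hne
    obtain ⟨i, hi⟩ : ∃ i, limitDigit (Nat.pair (queryIndex (T, x, p)) i) ≠ 1 := by
      by_contra! hall
      refine hne ?_
      exact (tsum_congr fun i => if_pos (hall i)).trans hasSum_half_pow_succ.tsum_eq
    have hi0 : limitDigit (Nat.pair (queryIndex (T, x, p)) i) = 0 := by
      have := limitDigit_lt_two (Nat.pair (queryIndex (T, x, p)) i)
      omega
    obtain ⟨k, hk, hk'⟩ := ((eventually_lt_outMass tendsto_id tendsto_digitMass_limitDigit h).and
      (eventually_bitTable_prefixValue (Nat.pair (queryIndex (T, x, p)) i))).exists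
    exact not_refutes_limitDigit k _ i k ((refutes_encode_iff _ (T, x, p) i k).2
      (Or.inl ⟨hk'.trans hi0, hk⟩))
  · by_contra hne
    obtain ⟨i, hi⟩ : ∃ i, limitDigit (Nat.pair (queryIndex (T, x, p)) i) = 1 := by
      by_contra! hall
      refine hne ?_
      rw [limitOracle, digitValue]
      simp [hall]
    obtain ⟨k, hk, hk'⟩ := ((eventually_lt_outMass tendsto_id tendsto_digitMass_limitDigit h).and
      (eventually_bitTable_prefixValue (Nat.pair (queryIndex (T, x, p)) i))).exists
    exact not_refutes_limitDigit k _ i k ((refutes_encode_iff _ (T, x, p) i k).2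
      (Or.inr ⟨hk'.trans hi, hk⟩))

/-- The number of units of `2 ^ (-k)` assigned to the query with code `c` by the greatest
admissible table with `k` bits. -/
noncomputable def approxMass (c k : ℕ) : ℕ :=
  digitMass (bitTable (greatestAdmissible k) k) k (queryRank c) 1

/-- The rational with numerator `2 * n + 1` and denominator `2 ^ (k + 1)`. -/
def oddDyadic (n k : ℕ) : ℚ where
  num := (2 * n + 1 : ℕ)
  den := 2 ^ (k + 1)
  den_nz := by positivity
  reduced := by
    rw [Int.natAbs_natCast]
    exact Nat.Coprime.pow_right _ (by simp)

theorem tendsto_oddDyadic_approxMass (q : Query) :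
    Tendsto (fun k => ((oddDyadic (approxMass (Encodable.encode q) k) k : ℚ) : ℝ)) atTop
      (𝓝 (limitOracle q)) := by
  have h := tendsto_digitMass (c := queryIndex q)
    (fun i => eventually_bitTable_greatestAdmissible (Nat.pair (queryIndex q) i)) 1
  have h2 := h.add hasSum_half_pow_succ.summable.tendsto_atTop_zero
  rw [add_zero] at h2
  refine h2.congr fun k => ?_
  rw [Rat.cast_def, approxMass, queryRank_encode]
  simp only [oddDyadic, one_div, inv_pow]
  push_cast
  field_simp
  ring

theorem primrec_greatestAdmissible : Primrec greatestAdmissible :=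
  Primrec.nat_findGreatest (p := fun k n => Admissible n k)
    (Primrec.nat_sub.comp (primrec_two_pow Primrec.id) (Primrec.const 1))
    primrecRel_admissible.swap

theorem primrec_approxMass : Primrec₂ approxMass := by
  have hg := primrec_greatestAdmissible.comp (Primrec.snd (α := ℕ) (β := ℕ))
  have hD : Primrec₂ fun (p : ℕ × ℕ) i => bitTable (greatestAdmissible p.2) p.2 i :=
    primrec_bitTable (hg.comp Primrec.fst) (Primrec.snd.comp Primrec.fst) Primrec.snd
  exact primrec_digitMass hD Primrec.snd (primrec_queryRank.comp Primrec.fst) (Primrec.const 1)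

theorem primrec_oddDyadic : Primrec₂ oddDyadic := by
  have hcount : Primrec ratRank := primrec_count primrecPred_mem_range_encode_rat
  refine Primrec₂.encode_iff.1 ((hcount.comp (Primrec₂.natPair.comp (Primrec.nat_mul.comp
    (Primrec.const 2) (Primrec.succ.comp (Primrec.nat_mul.comp (Primrec.const 2) Primrec.fst)))
    (primrec_two_pow (Primrec.succ.comp Primrec.snd)))).of_eq fun p => ?_)
  exact (encode_ofEncodableOfInfinite (oddDyadic p.1 p.2)).symm

theorem limitComputable_limitOracle : LimitComputable limitOracle :=
  ⟨fun c k => oddDyadic (approxMass c k) k,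
    (primrec_oddDyadic.comp primrec_approxMass Primrec.snd).to_comp,
    tendsto_oddDyadic_approxMass⟩

end LimitOracle

end GrainOfTruth

theorem exists_limit_computable_reflective_oracle :
    ∃ O : GrainOfTruth.Query → ℝ,
      GrainOfTruth.Reflective O ∧ GrainOfTruth.LimitComputable O :=
  ⟨GrainOfTruth.limitOracle, GrainOfTruth.reflective_limitOracle,
    GrainOfTruth.limitComputable_limitOracle⟩
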